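/- Let u be a time-global classical solution of problem (B) whose initial data u0 ∈ C^1([-1,1]) satisfies: u0 is even, 1 ≤ u0(x) ≤ M0 on [-1,1], 0 < u0'(x) < tan(πx/2) for x ∈ (0,1), and u0'(1) = u0(1). Then for every h0 > 0 there exists T* > 0 such that for all t ≥ T* and all x ∈ (0,1): u_x(x,t) ≥ tan((arctan h0)·x) > 0 and u_x(-x,t) ≤ -tan((arctan h0)·x) < 0. -/

import Mathlib

open Real

/-- Partial derivative in `x` of a function `u(x,t)`. -/
noncomputable def ux (u : ℝ → ℝ → ℝ) (x t : ℝ) : ℝ := deriv (fun y => u y t) x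

/-- Second partial derivative in `x` of a function `u(x,t)`. -/
noncomputable def uxx (u : ℝ → ℝ → ℝ) (x t : ℝ) : ℝ := deriv (fun y => ux u y t) x

/-- Partial derivative in `t` of a function `u(x,t)`. -/
noncomputable def ut (u : ℝ → ℝ → ℝ) (x t : ℝ) : ℝ := deriv (fun s => u x s) t

/-- A time-global classical solution of problem (B) with initial data `u0`:
`u` and `u_x` are continuous on `[-1,1] × [0,∞)`, `u` is `C^{2,1}` in
`(-1,1) × (0,∞)` where it satisfies `u_t = u_xx/(1+u_x²)`, with boundary
conditions `u_x(±1,t) = ±u(±1,t)` for `t > 0` and initial condition `u(·,0) = u0`. -/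
def IsGlobalSolB (u : ℝ → ℝ → ℝ) (u0 : ℝ → ℝ) : Prop :=
  ContinuousOn (fun p : ℝ × ℝ => u p.1 p.2) (Set.Icc (-1 : ℝ) 1 ×ˢ Set.Ici (0 : ℝ)) ∧
  ContinuousOn (fun p : ℝ × ℝ => ux u p.1 p.2) (Set.Icc (-1 : ℝ) 1 ×ˢ Set.Ici (0 : ℝ)) ∧
  (∀ t > (0 : ℝ), ∀ x ∈ Set.Ioo (-1 : ℝ) 1,
    DifferentiableAt ℝ (fun y => u y t) x ∧
    DifferentiableAt ℝ (fun y => ux u y t) x ∧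
    DifferentiableAt ℝ (fun s => u x s) t ∧
    ut u x t = uxx u x t / (1 + ux u x t ^ 2)) ∧
  (∀ t > (0 : ℝ), ux u 1 t = u 1 t ∧ ux u (-1) t = - u (-1) t) ∧
  (∀ x ∈ Set.Icc (-1 : ℝ) 1, u x 0 = u0 x)

section helpers
open Set Filter Topology

lemma first_touch {α : Type*} [TopologicalSpace α] (K : Set α) (hK : IsCompact K)
    (f : α → ℝ → ℝ) (a b : ℝ)
    (hf : ContinuousOn (fun p : α × ℝ => f p.1 p.2) (K ×ˢ Icc a b))
    (h0 : ∀ q ∈ K, 0 < f q a)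
    (hno : ∀ q ∈ K, ∀ t ∈ Ioc a b, f q t = 0 → (∀ q' ∈ K, 0 ≤ f q' t) →
      (∀ s ∈ Ico a t, 0 ≤ f q s) → False) :
    ∀ q ∈ K, ∀ t ∈ Icc a b, 0 < f q t := by
  by_contra! hcon
  obtain ⟨q1, hq1, t1, ht1, hle⟩ := hcon
  have hKc : IsCompact (K ×ˢ Icc a b) := hK.prod isCompact_Icc
  -- image of the bad set in time
  obtain ⟨g, hg⟩ : ∃ g : α × ℝ → ℝ, g = fun p => f p.1 p.2 := ⟨_, rfl⟩
  rw [← hg] at hf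
  have hS : IsCompact {p : ↥(K ×ˢ Icc a b) | g p ≤ 0} := by
    have : CompactSpace ↥(K ×ˢ Icc a b) := isCompact_iff_compactSpace.mp hKc
    apply IsClosed.isCompact
    exact isClosed_le (continuousOn_iff_continuous_domRestrict.mp hf) continuous_const
  obtain ⟨⟨⟨q0, s0⟩, hm⟩, hp, hmin⟩ := hS.exists_isMinOn (f := fun p => (p : α × ℝ).2)
    ⟨⟨(q1, t1), ⟨hq1, ht1⟩⟩, by simpa [hg] using hle⟩
    (continuous_snd.comp continuous_subtype_val).continuousOn
  have hp' : f q0 s0 ≤ 0 := by simpa [hg] using hp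
  have hq0 : q0 ∈ K := hm.1
  have hs0 : s0 ∈ Icc a b := hm.2
  have has : a < s0 := by
    rcases hs0.1.eq_or_lt with h | h
    · have := h0 q0 hq0
      rw [h] at this; linarith
    · exact h
  have hbefore : ∀ q ∈ K, ∀ s ∈ Ico a s0, 0 < f q s := by
    intro q hq s hs
    by_contra! hneg
    have hsb : s ∈ Icc a b := ⟨hs.1, hs.2.le.trans hs0.2⟩
    have := hmin (show (⟨(q, s), ⟨hq, hsb⟩⟩ : ↥(K ×ˢ Icc a b)) ∈ _ by simpa [hg] using hneg)
    simp at this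
    linarith [hs.2]
  have hat : ∀ q ∈ K, 0 ≤ f q s0 := by
    intro q hq
    have hc : ContinuousOn (fun s => f q s) (Icc a b) := by
      have := hf.comp (f := fun s : ℝ => (q, s)) (s := Icc a b) (by fun_prop) (fun s hs => ⟨hq, hs⟩)
      rw [hg] at this; exact this
    have h1 : Tendsto (fun s => f q s) (𝓝[Ico a s0] s0) (𝓝 (f q s0)) :=
      (hc s0 hs0).mono_left (nhdsWithin_mono _ (fun s hs => ⟨hs.1, hs.2.le.trans hs0.2⟩))
    have : (𝓝[Ico a s0] s0).NeBot := by
      rw [nhdsWithin_Ico_eq_nhdsLT has]; infer_instance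
    exact ge_of_tendsto h1 (by
      filter_upwards [self_mem_nhdsWithin] with s hs using (hbefore q hq s hs).le)
  exact hno q0 hq0 s0 ⟨has, hs0.2⟩ (le_antisymm hp' (hat q0 hq0)) hat
    (fun s hs => (hbefore q0 hq0 s hs).le)

lemma deriv_left_nonpos {g : ℝ → ℝ} {g' a b : ℝ} (hab : b < a) (hg : HasDerivAt g g' a)
    (h : ∀ s ∈ Ioo b a, g a ≤ g s) : g' ≤ 0 := by
  have h1 := (hasDerivAt_iff_tendsto_slope.mp hg).mono_left
    (nhdsWithin_mono a (show Iio a ⊆ {a}ᶜ from fun s hs => ne_of_lt hs))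
  refine le_of_tendsto h1 ?_
  filter_upwards [Ioo_mem_nhdsLT hab] with s hs
  rw [slope_def_field]
  exact div_nonpos_of_nonneg_of_nonpos (by linarith [h s hs]) (by linarith [hs.2])

lemma deriv_right_nonneg {g : ℝ → ℝ} {g' a b : ℝ} (hab : a < b) (hg : HasDerivAt g g' a)
    (h : ∀ s ∈ Ioo a b, g a ≤ g s) : 0 ≤ g' := by
  have h1 := (hasDerivAt_iff_tendsto_slope.mp hg).mono_left
    (nhdsWithin_mono a (show Ioi a ⊆ {a}ᶜ from fun s hs => ne_of_gt hs))
  refine ge_of_tendsto h1 ?_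
  filter_upwards [Ioo_mem_nhdsGT hab] with s hs
  rw [slope_def_field]
  exact div_nonneg (by linarith [h s hs]) (by linarith [hs.1])

lemma second_deriv_nonneg {g g1 : ℝ → ℝ} {g2 a : ℝ} (h : ∀ᶠ y in 𝓝 a, HasDerivAt g (g1 y) y)
    (h2 : HasDerivAt g1 g2 a) (hmin : IsLocalMin g a) : g1 a = 0 ∧ 0 ≤ g2 := by
  have hz : g1 a = 0 := hmin.hasDerivAt_eq_zero h.self_of_nhds
  refine ⟨hz, ?_⟩
  by_contra! hneg
  have hd : deriv g =ᶠ[𝓝 a] g1 := h.mono fun y hy => hy.deriv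
  have hdd : deriv (deriv g) a = g2 := by rw [hd.deriv_eq]; exact h2.deriv
  have hmax : IsLocalMax g a := isLocalMax_of_deriv_deriv_neg (by rw [hdd]; exact hneg)
    (by rw [hd.self_of_nhds, hz]) h.self_of_nhds.continuousAt
  have hconst : g =ᶠ[𝓝 a] fun _ => g a := by
    filter_upwards [hmin, hmax] with y h1 h2 using le_antisymm h2 h1
  have : deriv (deriv g) a = 0 := by
    rw [hconst.deriv.deriv_eq]; simp
  linarith

lemma hasDerivAt_of_deriv_pos {g : ℝ → ℝ} {a : ℝ} (h : deriv g a ≠ 0) :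
    HasDerivAt g (deriv g a) a := by
  by_contra hc
  apply h
  exact deriv_zero_of_not_differentiableAt fun hd => hc hd.hasDerivAt

/-- growth -/
lemma growth (u : ℝ → ℝ → ℝ) (u0 : ℝ → ℝ) (hu : IsGlobalSolB u u0)
    (hb : ∀ x ∈ Icc (-1 : ℝ) 1, 1 ≤ u0 x) :
    ∀ t ≥ (0 : ℝ), ∀ x ∈ Icc (-1 : ℝ) 1, x ^ 2 / 4 + t / 4 + 1 / 2 < u x t := by
  obtain ⟨hc, hcx, hintr, hbd, hini⟩ := hu
  intro T hT
  have key := first_touch (Icc (-1 : ℝ) 1) isCompact_Icc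
    (fun x t => u x t - (x ^ 2 / 4 + t / 4 + 1 / 2)) 0 T ?_ ?_ ?_
  · intro x hx
    have := key x hx T ⟨hT, le_rfl⟩
    linarith
  · exact (hc.mono (prod_mono le_rfl Icc_subset_Ici_self)).sub (by fun_prop)
  · intro x hx
    have := hb x hx
    rw [hini x hx]
    nlinarith [hx.1, hx.2]
  · intro x hx t ht h0 hsp htm
    have hut : u x t = x ^ 2 / 4 + t / 4 + 1 / 2 := by linarith
    have hupos : 0 < u x t := by rw [hut]; nlinarith [ht.1, sq_nonneg x]
    rcases hx.2.eq_or_lt with h1 | h1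
    · subst h1
      have hd : HasDerivAt (fun y => u y t) (u 1 t) 1 := by
        have e := (hbd t ht.1).1
        have := hasDerivAt_of_deriv_pos (g := fun y => u y t) (a := 1) (by
          unfold ux at e; rw [e]; exact hupos.ne')
        unfold ux at e; rwa [e] at this
      have h2 : HasDerivAt (fun y : ℝ => u y t - (y ^ 2 / 4 + t / 4 + 1 / 2))
          (u 1 t - (2 * 1 / 4)) 1 := by
        refine hd.sub ?_
        have := (((hasDerivAt_pow 2 (1 : ℝ)).div_const 4).add_const (t / 4)).add_const (1 / 2)
        simpa using this
      have := deriv_left_nonpos (b := -1) (by norm_num) h2 (fun s hs => by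
        have := hsp s ⟨hs.1.le, hs.2.le⟩
        linarith)
      rw [hut] at this
      linarith [ht.1]
    rcases hx.1.eq_or_lt with h1' | h1'
    · subst h1'
      have hd : HasDerivAt (fun y => u y t) (-u (-1) t) (-1) := by
        have e := (hbd t ht.1).2
        have := hasDerivAt_of_deriv_pos (g := fun y => u y t) (a := -1) (by
          unfold ux at e; rw [e]; linarith)
        unfold ux at e; rwa [e] at this
      have h2 : HasDerivAt (fun y : ℝ => u y t - (y ^ 2 / 4 + t / 4 + 1 / 2))
          (-u (-1) t - (2 * (-1) / 4)) (-1) := by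
        refine hd.sub ?_
        have := (((hasDerivAt_pow 2 (-1 : ℝ)).div_const 4).add_const (t / 4)).add_const (1 / 2)
        simpa using this
      have := deriv_right_nonneg (b := 1) (by norm_num) h2 (fun s hs => by
        have := hsp s ⟨hs.1.le, hs.2.le⟩
        linarith)
      rw [hut] at this
      linarith [ht.1]
    have hxo : x ∈ Ioo (-1 : ℝ) 1 := ⟨h1', h1⟩
    obtain ⟨-, hd2, hdt, heq⟩ := hintr t ht.1 x hxo
    have hnear : ∀ᶠ y in 𝓝 x, y ∈ Ioo (-1 : ℝ) 1 := isOpen_Ioo.mem_nhds hxo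
    have hsec := second_deriv_nonneg (a := x)
      (g := fun y => u y t - (y ^ 2 / 4 + t / 4 + 1 / 2))
      (g1 := fun y => ux u y t - y / 2) (g2 := uxx u x t - 1 / 2) ?_ ?_ ?_
    · obtain ⟨e1, e2⟩ := hsec
      have htd := deriv_left_nonpos (b := 0) (a := t) (g := fun s => u x s - (x ^ 2 / 4 + s / 4 + 1 / 2))
        (g' := ut u x t - 1 / 4) ht.1 ?_ ?_
      · rw [heq] at htd
        have : 0 < 1 + ux u x t ^ 2 := by positivity
        have h3 : uxx u x t / (1 + ux u x t ^ 2) ≤ 1 / 4 := by linarith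
        rw [div_le_iff₀ this] at h3
        have h4 : ux u x t = x / 2 := by linarith
        rw [h4] at h3
        nlinarith [hx.1, hx.2]
      · refine hdt.hasDerivAt.sub ?_
        have := (((hasDerivAt_id t).div_const 4).const_add (x ^ 2 / 4)).add_const (1 / 2)
        simpa using this
      · intro s hs
        have := htm s ⟨hs.1.le, hs.2⟩
        linarith
    · filter_upwards [hnear] with y hy
      refine (hintr t ht.1 y hy).1.hasDerivAt.sub ?_
      have := (((hasDerivAt_pow 2 y).div_const 4).add_const (t / 4)).add_const (1 / 2)
      convert this using 1
      simp; ring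
    · exact hd2.hasDerivAt.sub ((hasDerivAt_id x).div_const 2)
    · filter_upwards [hnear] with y hy
      have := hsp y ⟨hy.1.le, hy.2.le⟩
      linarith

/-- doubling function -/
noncomputable def Psi (v : ℝ → ℝ) (e d x y : ℝ) : ℝ :=
  e * (x + y) ^ 2 / 2 + d * (2 + x ^ 2 + y ^ 2) / 2 + (x ^ 2 - y ^ 2) / 2
    - Real.log (v x) + Real.log (v y)

lemma hess (v v1 : ℝ → ℝ) (x y vx vy e d : ℝ) (hx : x ∈ Ioo (-1 : ℝ) 1) (hy : y ∈ Ioo (-1 : ℝ) 1)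
    (hpos : ∀ z ∈ Ioo (-1 : ℝ) 1, 0 < v z)
    (hv : ∀ z ∈ Ioo (-1 : ℝ) 1, HasDerivAt v (v1 z) z)
    (hvx : HasDerivAt v1 vx x) (hvy : HasDerivAt v1 vy y)
    (hmin : ∀ x' ∈ Ioo (-1 : ℝ) 1, ∀ y' ∈ Ioo (-1 : ℝ) 1, Psi v e d x y ≤ Psi v e d x' y')
    (α β : ℝ) :
    α * (e * (x + y) + d * x + x - v1 x / v x) + β * (e * (x + y) + d * y - y + v1 y / v y) = 0 ∧
    0 ≤ α ^ 2 * (e + d + 1) + 2 * α * β * e + β ^ 2 * (e + d - 1)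
      - α ^ 2 * (vx / v x - (v1 x / v x) ^ 2) + β ^ 2 * (vy / v y - (v1 y / v y) ^ 2) := by
  have hX : ∀ s : ℝ, HasDerivAt (fun s => x + α * s) α s := fun s => by
    simpa using ((hasDerivAt_id s).const_mul α).const_add x
  have hY : ∀ s : ℝ, HasDerivAt (fun s => y + β * s) β s := fun s => by
    simpa using ((hasDerivAt_id s).const_mul β).const_add y
  have nX : ∀ᶠ s in 𝓝 (0 : ℝ), x + α * s ∈ Ioo (-1 : ℝ) 1 := by
    apply (hX 0).continuousAt.eventually_mem
    simpa using isOpen_Ioo.mem_nhds hx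
  have nY : ∀ᶠ s in 𝓝 (0 : ℝ), y + β * s ∈ Ioo (-1 : ℝ) 1 := by
    apply (hY 0).continuousAt.eventually_mem
    simpa using isOpen_Ioo.mem_nhds hy
  have key := second_deriv_nonneg (a := 0)
    (g := fun s => Psi v e d (x + α * s) (y + β * s))
    (g1 := fun s => α * (e * ((x + α * s) + (y + β * s)) + d * (x + α * s) + (x + α * s)
        - v1 (x + α * s) / v (x + α * s))
      + β * (e * ((x + α * s) + (y + β * s)) + d * (y + β * s) - (y + β * s)
        + v1 (y + β * s) / v (y + β * s)))
    (g2 := α ^ 2 * (e + d + 1) + 2 * α * β * e + β ^ 2 * (e + d - 1)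
      - α ^ 2 * (vx / v x - (v1 x / v x) ^ 2) + β ^ 2 * (vy / v y - (v1 y / v y) ^ 2)) ?_ ?_ ?_
  · simpa using key
  · filter_upwards [nX, nY] with s h1 h2
    have a1 := (hv _ h1).comp s (hX s)
    have a2 := (hv _ h2).comp s (hY s)
    have b1 := a1.log (hpos _ h1).ne'
    have b2 := a2.log (hpos _ h2).ne'
    have c1 := ((((hX s).add (hY s)).pow 2).const_mul e).div_const 2
    have c2 := (((((hX s).pow 2).const_add 2).add ((hY s).pow 2)).const_mul d).div_const 2
    have c3 := (((hX s).pow 2).sub ((hY s).pow 2)).div_const 2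
    have := (((c1.add c2).add c3).sub b1).add b2
    refine HasDerivAt.congr_deriv this ?_
    simp only [Pi.add_apply, Function.comp_apply]
    norm_num
    ring
  · have e1 : HasDerivAt v1 vx (x + α * 0) := by simpa using hvx
    have e2 : HasDerivAt v1 vy (y + β * 0) := by simpa using hvy
    have a1 := e1.comp 0 (hX 0)
    have a2 := e2.comp 0 (hY 0)
    have b1 := (hv (x + α * 0) (by simpa using hx)).comp 0 (hX 0)
    have b2 := (hv (y + β * 0) (by simpa using hy)).comp 0 (hY 0)
    have q1 := a1.div b1 (by simpa using (hpos _ hx).ne')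
    have q2 := a2.div b2 (by simpa using (hpos _ hy).ne')
    have s0 := ((hX 0).add (hY 0)).const_mul e
    have t1 := (((s0.add ((hX 0).const_mul d)).add (hX 0)).sub q1).const_mul α
    have t2 := (((s0.add ((hY 0).const_mul d)).sub (hY 0)).add q2).const_mul β
    have := t1.add t2
    refine HasDerivAt.congr_deriv this ?_
    have := (hpos _ hx).ne'
    have := (hpos _ hy).ne'
    simp only [Function.comp_apply, mul_zero, add_zero]
    field_simp
    ring
  · filter_upwards [nX, nY] with s h1 h2
    simpa using hmin _ h1 _ h2

lemma lipA (a b : ℝ) : |1 / √(1 + a ^ 2) - 1 / √(1 + b ^ 2)| ≤ |a + b| := by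
  have ha : 0 < 1 + a ^ 2 := by positivity
  have hb : 0 < 1 + b ^ 2 := by positivity
  set s := √(1 + a ^ 2) with hs
  set r := √(1 + b ^ 2) with hr
  have s2 : s ^ 2 = 1 + a ^ 2 := Real.sq_sqrt ha.le
  have r2 : r ^ 2 = 1 + b ^ 2 := Real.sq_sqrt hb.le
  have s1 : 1 ≤ s := by rw [hs]; apply Real.one_le_sqrt.mpr; nlinarith
  have r1 : 1 ≤ r := by rw [hr]; apply Real.one_le_sqrt.mpr; nlinarith
  have sa : |a| ≤ s := by rw [hs]; apply Real.abs_le_sqrt; linarith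
  have rb : |b| ≤ r := by rw [hr]; apply Real.abs_le_sqrt; linarith
  have e : 1 / s - 1 / r = (r - s) / (s * r) := by
    field_simp
  rw [e, abs_div, abs_of_pos (show 0 < s * r by positivity)]
  rw [div_le_iff₀ (by positivity)]
  have h1 : |r - s| * (r + s) = |a + b| * |b - a| := by
    rw [← abs_of_pos (show 0 < r + s by positivity), ← abs_mul, ← abs_mul]
    congr 1
    nlinarith
  have h2 : |b - a| ≤ r + s := (abs_sub b a).trans (by linarith)
  have h3 : |r - s| ≤ |a + b| := by
    have : |r - s| * (r + s) ≤ |a + b| * (r + s) := by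
      rw [h1]; exact mul_le_mul_of_nonneg_left h2 (abs_nonneg _)
    exact le_of_mul_le_mul_right this (by positivity)
  have : 1 ≤ s * r := by nlinarith
  nlinarith [abs_nonneg (a + b)]

set_option maxHeartbeats 1000000 in
lemma alg_bound (G M c1 R P E D ε c x y u1 u2 a1 a2 A1 A2 : ℝ)
    (hG : 1 ≤ G) (hM : 1 ≤ M) (hc1 : 1 ≤ c1) (hR : R = 2 * G + 2) (hP : P = 2 * c1 + R)
    (hE : E = R ^ 2 / 2 + 2 * c1 + R) (hD : D = M * P + M * E * (2 * G))
    (hε : 0 < ε) (hεc : ε * c1 ≤ 1) (hc : 0 ≤ c) (hcc : c ≤ c1)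
    (hx : x ∈ Icc (-1 : ℝ) 1) (hy : y ∈ Icc (-1 : ℝ) 1)
    (hu1 : 1 / 2 ≤ u1) (hu1M : u1 ≤ M) (hu2 : 1 / 2 ≤ u2) (hu2M : u2 ≤ M)
    (ha1 : |a1| ≤ G) (ha2 : |a2| ≤ G)
    (hp1 : 1 / ε * (x + y) + ε * c * x + x - a1 / u1 = 0)
    (hp2 : 1 / ε * (x + y) + ε * c * y - y + a2 / u2 = 0)
    (hl : 1 / ε * (x + y) ^ 2 / 2 + ε * c * (2 + x ^ 2 + y ^ 2) / 2 + (x ^ 2 - y ^ 2) / 2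
      - Real.log u1 + Real.log u2 = 0)
    (hA1 : A1 = 1 / √(1 + a1 ^ 2)) (hA2 : A2 = 1 / √(1 + a2 ^ 2)) :
    A1 ^ 2 * (1 / ε + ε * c + 1) - 2 * A1 * A2 * (1 / ε) + A2 ^ 2 * (1 / ε + ε * c - 1)
      + A1 ^ 2 * (a1 / u1) ^ 2 - A2 ^ 2 * (a2 / u2) ^ 2
    ≤ ε * (D ^ 2 + 2 * c1 + 2 * D + 4 * G * P + 8 * G ^ 2 * D) := by
  obtain ⟨hx1, hx2⟩ := hx
  obtain ⟨hy1, hy2⟩ := hy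
  have hu1p : 0 < u1 := by linarith
  have hu2p : 0 < u2 := by linarith
  have hd0 : 0 ≤ ε * c := by positivity
  have hd1 : ε * c ≤ ε * c1 := by gcongr
  set p1 := a1 / u1 with hp1d
  set p2 := a2 / u2 with hp2d
  have hp1b : |p1| ≤ 2 * G := by
    rw [hp1d, abs_div, abs_of_pos hu1p, div_le_iff₀ hu1p]
    have := mul_le_mul_of_nonneg_left hu1 (show 0 ≤ 2 * G by linarith)
    linarith
  have hp2b : |p2| ≤ 2 * G := by
    rw [hp2d, abs_div, abs_of_pos hu2p, div_le_iff₀ hu2p]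
    have := mul_le_mul_of_nonneg_left hu2 (show 0 ≤ 2 * G by linarith)
    linarith
  have habsx : |x| ≤ 1 := abs_le.mpr ⟨hx1, hx2⟩
  have habsy : |y| ≤ 1 := abs_le.mpr ⟨hy1, hy2⟩
  have hr : |x + y| ≤ ε * R := by
    have h1 : x + y = ε * (p1 - ε * c * x - x) := by
      have : 1 / ε * (x + y) = p1 - ε * c * x - x := by linarith
      field_simp at this; linarith
    rw [h1, abs_mul, abs_of_pos hε]
    gcongr
    have t1 : |ε * c * x| ≤ 1 := by
      rw [abs_mul, abs_of_nonneg hd0]; exact mul_le_one₀ (by linarith) (abs_nonneg x) habsx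
    have t2 := abs_sub (p1 - ε * c * x) x
    have t3 := abs_sub p1 (ε * c * x)
    rw [hR]; linarith
  have hR0 : 0 < R := by rw [hR]; linarith
  have hP0 : 0 < P := by rw [hP]; linarith
  have hE0 : 0 < E := by rw [hE]; positivity
  have hD0 : 0 < D := by rw [hD]; positivity
  have hpp : |p1 + p2| ≤ ε * P := by
    have h1 : p1 + p2 = ε * c * (x - y) + (x + y) := by linarith
    rw [h1]
    have t1 : |ε * c * (x - y)| ≤ ε * c1 * 2 := by
      rw [abs_mul, abs_of_nonneg hd0]
      have := abs_sub x y
      gcongr; linarith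
    have := abs_add_le (ε * c * (x - y)) (x + y)
    have e2 : ε * P = ε * c1 * 2 + ε * R := by rw [hP]; ring
    linarith
  set ℓ := Real.log u1 - Real.log u2 with hℓ
  have hell : |ℓ| ≤ ε * E := by
    have h1 : ℓ = 1 / ε * (x + y) ^ 2 / 2 + ε * c * (2 + x ^ 2 + y ^ 2) / 2 + (x ^ 2 - y ^ 2) / 2 := by
      linarith
    have t1 : 1 / ε * (x + y) ^ 2 / 2 ≤ ε * R ^ 2 / 2 := by
      have : (x + y) ^ 2 ≤ (ε * R) ^ 2 := by rw [← sq_abs (x + y)]; gcongr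
      have : 1 / ε * (x + y) ^ 2 ≤ 1 / ε * (ε * R) ^ 2 := by gcongr
      have e : 1 / ε * (ε * R) ^ 2 = ε * R ^ 2 := by field_simp
      linarith
    have t1' : 0 ≤ 1 / ε * (x + y) ^ 2 / 2 := by positivity
    have t2 : ε * c * (2 + x ^ 2 + y ^ 2) / 2 ≤ ε * c1 * 2 := by
      have : 2 + x ^ 2 + y ^ 2 ≤ 4 := by
        linarith [(sq_le_one_iff_abs_le_one x).mpr habsx, (sq_le_one_iff_abs_le_one y).mpr habsy]
      have : ε * c * (2 + x ^ 2 + y ^ 2) ≤ ε * c1 * 4 := by gcongr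
      linarith
    have t2' : 0 ≤ ε * c * (2 + x ^ 2 + y ^ 2) / 2 := by positivity
    have t3 : |(x ^ 2 - y ^ 2) / 2| ≤ ε * R := by
      have : (x ^ 2 - y ^ 2) / 2 = (x + y) * ((x - y) / 2) := by ring
      rw [this, abs_mul]
      have : |(x - y) / 2| ≤ 1 := by rw [abs_le]; constructor <;> linarith
      calc |x + y| * |(x - y) / 2| ≤ |x + y| * 1 := by gcongr
        _ ≤ ε * R := by linarith
    have t4 := abs_le.mp t3
    have e2 : ε * E = ε * R ^ 2 / 2 + ε * c1 * 2 + ε * R := by rw [hE]; ring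
    have e3 : 0 ≤ ε * R ^ 2 / 2 := by positivity
    have e4 : 0 ≤ ε * c1 * 2 := by positivity
    rw [abs_le, h1, e2]
    constructor
    · linarith [t4.1]
    · linarith [t4.2]
  have hlog : ∀ a b : ℝ, 0 < a → 0 < b → (a - b) ≤ a * (Real.log a - Real.log b) := by
    intro a b ha hb
    have := Real.log_le_sub_one_of_pos (div_pos hb ha)
    rw [Real.log_div hb.ne' ha.ne'] at this
    have h2 : a * (Real.log b - Real.log a) ≤ a * (b / a - 1) := by gcongr
    have h3 : a * (b / a - 1) = b - a := by field_simp
    have h4 : a * (Real.log a - Real.log b) = -(a * (Real.log b - Real.log a)) := by ring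
    linarith
  have hudiff : |u1 - u2| ≤ M * (ε * E) := by
    have g1 := hlog u1 u2 hu1p hu2p
    have g2 := hlog u2 u1 hu2p hu1p
    have l1 := abs_le.mp hell
    have b0 : 0 ≤ ε * E := by positivity
    rw [abs_le]
    constructor
    · have : u2 * (Real.log u2 - Real.log u1) ≤ u2 * (ε * E) := by
        gcongr; linarith [l1.1]
      have : u2 * (ε * E) ≤ M * (ε * E) := by gcongr
      linarith
    · have : u1 * (Real.log u1 - Real.log u2) ≤ u1 * (ε * E) := by
        gcongr; linarith [l1.2]
      have : u1 * (ε * E) ≤ M * (ε * E) := by gcongr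
      linarith
  have haa : |a1 + a2| ≤ ε * D := by
    have e1 : a1 + a2 = u1 * (p1 + p2) - (u1 - u2) * p2 := by
      rw [hp1d, hp2d]; field_simp; ring
    rw [e1]
    have t0 := abs_sub (u1 * (p1 + p2)) ((u1 - u2) * p2)
    have t1 : |u1 * (p1 + p2)| ≤ M * (ε * P) := by
      rw [abs_mul, abs_of_pos hu1p]; gcongr
    have t2 : |(u1 - u2) * p2| ≤ M * (ε * E) * (2 * G) := by
      rw [abs_mul]; gcongr
    have e2 : ε * D = M * (ε * P) + M * (ε * E) * (2 * G) := by rw [hD]; ring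
    linarith
  have hAd : |A1 - A2| ≤ ε * D := by
    rw [hA1, hA2]; exact (lipA a1 a2).trans haa
  have hAle : ∀ a : ℝ, 1 / √(1 + a ^ 2) ≤ 1 := fun a => by
    rw [div_le_one (by positivity)]
    apply Real.one_le_sqrt.mpr; linarith [sq_nonneg a]
  have hA1b : A1 ≤ 1 := hA1 ▸ hAle a1
  have hA2b : A2 ≤ 1 := hA2 ▸ hAle a2
  have hA1p : 0 < A1 := by rw [hA1]; positivity
  have hA2p : 0 < A2 := by rw [hA2]; positivity
  have hA1s : A1 ^ 2 ≤ 1 := pow_le_one₀ hA1p.le hA1b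
  have hA2s : A2 ^ 2 ≤ 1 := pow_le_one₀ hA2p.le hA2b
  have hsq : |A1 ^ 2 - A2 ^ 2| ≤ 2 * (ε * D) := by
    have : A1 ^ 2 - A2 ^ 2 = (A1 + A2) * (A1 - A2) := by ring
    rw [this, abs_mul, abs_of_pos (by positivity)]
    gcongr; linarith
  have hsq' := (le_abs_self _).trans hsq
  have m1 : 1 / ε * (A1 - A2) ^ 2 ≤ ε * D ^ 2 := by
    have : (A1 - A2) ^ 2 ≤ (ε * D) ^ 2 := by rw [← sq_abs (A1 - A2)]; gcongr
    have : 1 / ε * (A1 - A2) ^ 2 ≤ 1 / ε * (ε * D) ^ 2 := by gcongr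
    have e : 1 / ε * (ε * D) ^ 2 = ε * D ^ 2 := by field_simp
    linarith
  have m2 : ε * c * (A1 ^ 2 + A2 ^ 2) ≤ ε * c1 * 2 := by gcongr; linarith
  have m3 : A1 ^ 2 * (p1 ^ 2 - p2 ^ 2) ≤ ε * P * (4 * G) := by
    have h1 : |p1 ^ 2 - p2 ^ 2| ≤ ε * P * (4 * G) := by
      have : p1 ^ 2 - p2 ^ 2 = (p1 + p2) * (p1 - p2) := by ring
      rw [this, abs_mul]
      have := abs_sub p1 p2
      gcongr; linarith
    have h2 := (le_abs_self _).trans h1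
    have h3 : 0 ≤ ε * P * (4 * G) := by positivity
    calc A1 ^ 2 * (p1 ^ 2 - p2 ^ 2) ≤ A1 ^ 2 * (ε * P * (4 * G)) := by gcongr
      _ ≤ 1 * (ε * P * (4 * G)) := by gcongr
      _ = _ := one_mul _
  have m4 : p2 ^ 2 * (A1 ^ 2 - A2 ^ 2) ≤ (2 * G) ^ 2 * (2 * (ε * D)) := by
    have : p2 ^ 2 ≤ (2 * G) ^ 2 := by rw [← sq_abs p2]; gcongr
    calc p2 ^ 2 * (A1 ^ 2 - A2 ^ 2) ≤ p2 ^ 2 * (2 * (ε * D)) := by gcongr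
      _ ≤ _ := by gcongr
  have eq1 : A1 ^ 2 * (1 / ε + ε * c + 1) - 2 * A1 * A2 * (1 / ε) + A2 ^ 2 * (1 / ε + ε * c - 1)
      + A1 ^ 2 * p1 ^ 2 - A2 ^ 2 * p2 ^ 2
      = 1 / ε * (A1 - A2) ^ 2 + ε * c * (A1 ^ 2 + A2 ^ 2) + (A1 ^ 2 - A2 ^ 2)
        + A1 ^ 2 * (p1 ^ 2 - p2 ^ 2) + p2 ^ 2 * (A1 ^ 2 - A2 ^ 2) := by ring
  have eq2 : ε * (D ^ 2 + 2 * c1 + 2 * D + 4 * G * P + 8 * G ^ 2 * D)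
      = ε * D ^ 2 + ε * c1 * 2 + 2 * (ε * D) + ε * P * (4 * G) + (2 * G) ^ 2 * (2 * (ε * D)) := by
    ring
  rw [eq1, eq2]
  linarith

lemma Psi_dx (v : ℝ → ℝ) (e d x y v' : ℝ) (hv : HasDerivAt v v' x) (h : 0 < v x) :
    HasDerivAt (fun z => Psi v e d z y) (e * (x + y) + d * x + x - v' / v x) x := by
  have hX := hasDerivAt_id x
  have c1 := (((hX.add_const y).pow 2).const_mul e).div_const 2
  have c2 := ((((hX.pow 2).const_add 2).add_const (y ^ 2)).const_mul d).div_const 2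
  have c3 := ((hX.pow 2).sub_const (y ^ 2)).div_const 2
  have := (((c1.add c2).add c3).sub (hv.log h.ne')).add_const (Real.log (v y))
  refine HasDerivAt.congr_deriv this ?_
  simp only [id]
  norm_num
  ring

lemma Psi_dy (v : ℝ → ℝ) (e d x y v' : ℝ) (hv : HasDerivAt v v' y) (h : 0 < v y) :
    HasDerivAt (fun z => Psi v e d x z) (e * (x + y) + d * y - y + v' / v y) y := by
  have hX := hasDerivAt_id y
  have c1 := (((hX.const_add x).pow 2).const_mul e).div_const 2
  have c2 := (((hX.pow 2).const_add (2 + x ^ 2)).const_mul d).div_const 2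
  have c3 := ((hX.pow 2).const_sub (x ^ 2)).div_const 2
  have := (((c1.add c2).add c3).sub_const (Real.log (v x))).add (hv.log h.ne')
  refine HasDerivAt.congr_deriv this ?_
  simp only [id]
  norm_num
  ring

lemma bdry_deriv (u : ℝ → ℝ → ℝ) (u0 : ℝ → ℝ) (hu : IsGlobalSolB u u0)
    (hpos : ∀ t ≥ (0 : ℝ), ∀ x ∈ Icc (-1 : ℝ) 1, 1 / 2 < u x t) (t : ℝ) (ht : 0 < t) :
    HasDerivAt (fun y => u y t) (u 1 t) 1 ∧ HasDerivAt (fun y => u y t) (-u (-1) t) (-1) := by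
  obtain ⟨e1, e2⟩ := hu.2.2.2.1 t ht
  have p1 := hpos t ht.le 1 (by norm_num)
  have p2 := hpos t ht.le (-1) (by norm_num)
  unfold ux at e1 e2
  constructor
  · have := hasDerivAt_of_deriv_pos (g := fun y => u y t) (a := 1) (by rw [e1]; linarith)
    rwa [e1] at this
  · have := hasDerivAt_of_deriv_pos (g := fun y => u y t) (a := -1) (by rw [e2]; linarith)
    rwa [e2] at this

lemma even_step (u : ℝ → ℝ → ℝ) (u0 : ℝ → ℝ) (hu : IsGlobalSolB u u0)
    (hpos : ∀ t ≥ (0 : ℝ), ∀ x ∈ Icc (-1 : ℝ) 1, 1 / 2 < u x t)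
    (T G M c0 c1 R P E D K : ℝ) (hG : 1 ≤ G) (hM : 1 ≤ M)
    (hbM : ∀ t ∈ Icc 0 T, ∀ x ∈ Icc (-1 : ℝ) 1, u x t ≤ M)
    (hbG : ∀ t ∈ Icc 0 T, ∀ x ∈ Icc (-1 : ℝ) 1, |ux u x t| ≤ G)
    (hc0 : c0 = (2 * G + 1) ^ 2) (hc1 : c1 = c0 + 1)
    (hR : R = 2 * G + 2) (hP : P = 2 * c1 + R)
    (hE : E = R ^ 2 / 2 + 2 * c1 + R) (hD : D = M * P + M * E * (2 * G))
    (hK : K = (D ^ 2 + 2 * c1 + 2 * D + 4 * G * P + 8 * G ^ 2 * D) + 1) (hK0 : 0 < K)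
    (t0 t1 : ℝ) (ht0 : 0 ≤ t0) (ht1 : t1 ≤ T) (hstep : (t1 - t0) * K ≤ 1)
    (hlip : ∀ x ∈ Icc (-1 : ℝ) 1, ∀ y ∈ Icc (-1 : ℝ) 1,
      Real.log (u x t0) - Real.log (u y t0) ≤ 2 * G * |x - y|)
    (heven : ∀ x ∈ Icc (-1 : ℝ) 1, u x t0 = u (-x) t0) :
    ∀ t ∈ Icc t0 t1, ∀ x ∈ Icc (-1 : ℝ) 1, Real.log (u x t) ≤ Real.log (u (-x) t) := by
  have hc0p : 0 < c0 := by rw [hc0]; positivity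
  have hc11 : 1 ≤ c1 := by linarith
  -- main claim for each ε
  have main : ∀ ε : ℝ, 0 < ε → ε * c1 ≤ 1 → ∀ q ∈ Icc (-1 : ℝ) 1 ×ˢ Icc (-1 : ℝ) 1,
      ∀ t ∈ Icc t0 t1,
      0 < Psi (fun z => u z t) (1 / ε) (ε * (c0 + K * (t - t0))) q.1 q.2 := by
    intro ε hε hεc
    have hcb : ∀ t ∈ Icc t0 t1, 0 < c0 + K * (t - t0) ∧ c0 + K * (t - t0) ≤ c1 := by
      intro t ht
      have a1 : 0 ≤ K * (t - t0) := mul_nonneg hK0.le (by linarith [ht.1])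
      have a2 : K * (t - t0) ≤ K * (t1 - t0) := by gcongr; exact ht.2
      constructor <;> linarith
    refine first_touch (Icc (-1 : ℝ) 1 ×ˢ Icc (-1 : ℝ) 1) (isCompact_Icc.prod isCompact_Icc)
      (fun q t => Psi (fun z => u z t) (1 / ε) (ε * (c0 + K * (t - t0))) q.1 q.2) t0 t1 ?_ ?_ ?_
    · have k1 : ContinuousOn (fun p : (ℝ × ℝ) × ℝ => u p.1.1 p.2)
          ((Icc (-1 : ℝ) 1 ×ˢ Icc (-1 : ℝ) 1) ×ˢ Icc t0 t1) :=
        hu.1.comp (f := fun p : (ℝ × ℝ) × ℝ => (p.1.1, p.2)) (by fun_prop)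
          (fun p hp => ⟨hp.1.1, ht0.trans hp.2.1⟩)
      have k2 : ContinuousOn (fun p : (ℝ × ℝ) × ℝ => u p.1.2 p.2)
          ((Icc (-1 : ℝ) 1 ×ˢ Icc (-1 : ℝ) 1) ×ˢ Icc t0 t1) :=
        hu.1.comp (f := fun p : (ℝ × ℝ) × ℝ => (p.1.2, p.2)) (by fun_prop)
          (fun p hp => ⟨hp.1.2, ht0.trans hp.2.1⟩)
      have l1 := k1.log (fun p hp => by
        have := hpos p.2 (ht0.trans hp.2.1) p.1.1 hp.1.1; linarith)
      have l2 := k2.log (fun p hp => by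
        have := hpos p.2 (ht0.trans hp.2.1) p.1.2 hp.1.2; linarith)
      unfold Psi
      exact (ContinuousOn.sub (by fun_prop) l1).add l2
    · rintro ⟨x, y⟩ ⟨hx, hy⟩
      simp only at hx hy
      have hy' : -y ∈ Icc (-1 : ℝ) 1 := ⟨by linarith [hy.2], by linarith [hy.1]⟩
      have h1 := hlip x hx (-y) hy'
      rw [← heven y hy, sub_neg_eq_add] at h1
      simp only [Psi, sub_self, mul_zero, add_zero]
      have h2 : (x ^ 2 - y ^ 2) / 2 ≥ -|x + y| := by
        have : |(x ^ 2 - y ^ 2) / 2| ≤ |x + y| := by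
          have e : (x ^ 2 - y ^ 2) / 2 = (x + y) * ((x - y) / 2) := by ring
          rw [e, abs_mul]
          have : |(x - y) / 2| ≤ 1 := by
            rw [abs_le]; constructor <;> linarith [hx.1, hx.2, hy.1, hy.2]
          calc |x + y| * |(x - y) / 2| ≤ |x + y| * 1 := by gcongr
            _ = _ := mul_one _
        linarith [(abs_le.mp this).1]
      have h3 : (2 * G + 1) * |x + y| ≤ 1 / ε * (x + y) ^ 2 / 2 + ε * c0 / 2 := by
        have e : 1 / ε * (x + y) ^ 2 / 2 + ε * c0 / 2 - (2 * G + 1) * |x + y|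
            = 1 / ε / 2 * (|x + y| - ε * (2 * G + 1)) ^ 2 := by
          rw [hc0, ← sq_abs (x + y)]; field_simp; ring
        have : 0 ≤ 1 / ε / 2 * (|x + y| - ε * (2 * G + 1)) ^ 2 := by positivity
        linarith
      have h4 : ε * c0 ≤ ε * c0 * (2 + x ^ 2 + y ^ 2) / 2 := by
        have : ε * c0 * (2 + x ^ 2 + y ^ 2) / 2 = ε * c0 + ε * c0 * (x ^ 2 + y ^ 2) / 2 := by ring
        have : 0 ≤ ε * c0 * (x ^ 2 + y ^ 2) / 2 := by positivity
        linarith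
      have h5 : 0 < ε * c0 := by positivity
      linarith
    · rintro ⟨x, y⟩ ⟨hx, hy⟩ t ht hz hsp htm
      simp only at hx hy hz htm
      have htp : 0 < t := lt_of_le_of_lt ht0 ht.1
      have htI : t ∈ Icc t0 t1 := ⟨ht.1.le, ht.2⟩
      have htT : t ∈ Icc 0 T := ⟨htp.le, ht.2.trans ht1⟩
      obtain ⟨hcp, hcle⟩ := hcb t htI
      set c := c0 + K * (t - t0) with hcdef
      have hdp : 0 < ε * c := by positivity
      obtain ⟨bd1, bd2⟩ := bdry_deriv u u0 hu hpos t htp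
      have hspx : ∀ x' ∈ Icc (-1 : ℝ) 1, ∀ y' ∈ Icc (-1 : ℝ) 1,
          Psi (fun z => u z t) (1 / ε) (ε * c) x y ≤ Psi (fun z => u z t) (1 / ε) (ε * c) x' y' := by
        intro x' hx' y' hy'
        rw [hz]; exact hsp (x', y') ⟨hx', hy'⟩
      have pos1 := hpos t htp.le
      have eip : 0 < 1 / ε := by positivity
      have up1 : u 1 t / u 1 t = 1 := div_self (by linarith [pos1 1 (by norm_num)])
      have up2 : -u (-1) t / u (-1) t = -1 := by
        rw [neg_div, div_self (by linarith [pos1 (-1) (by norm_num)])]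
      rcases hx.2.eq_or_lt with h | hx2
      · subst h
        have := deriv_left_nonpos (b := -1) (by norm_num)
          (Psi_dx (fun z => u z t) (1 / ε) (ε * c) 1 y _ bd1 (by linarith [pos1 1 hx]))
          (fun s hs => hspx s ⟨hs.1.le, hs.2.le⟩ y hy)
        simp only [up1] at this
        have : 0 ≤ 1 / ε * (1 + y) := mul_nonneg eip.le (by linarith [hy.1])
        linarith
      rcases hx.1.eq_or_lt with h | hx1
      · subst h
        have := deriv_right_nonneg (b := 1) (by norm_num)
          (Psi_dx (fun z => u z t) (1 / ε) (ε * c) (-1) y _ bd2 (by linarith [pos1 (-1) hx]))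
          (fun s hs => hspx s ⟨hs.1.le, hs.2.le⟩ y hy)
        simp only [up2] at this
        have : 0 ≤ 1 / ε * (1 - y) := mul_nonneg eip.le (by linarith [hy.2])
        linarith
      rcases hy.2.eq_or_lt with h | hy2
      · subst h
        have := deriv_left_nonpos (b := -1) (by norm_num)
          (Psi_dy (fun z => u z t) (1 / ε) (ε * c) x 1 _ bd1 (by linarith [pos1 1 hy]))
          (fun s hs => hspx x hx s ⟨hs.1.le, hs.2.le⟩)
        simp only [up1] at this
        have : 0 ≤ 1 / ε * (1 + x) := mul_nonneg eip.le (by linarith [hx.1])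
        linarith
      rcases hy.1.eq_or_lt with h | hy1
      · subst h
        have := deriv_right_nonneg (b := 1) (by norm_num)
          (Psi_dy (fun z => u z t) (1 / ε) (ε * c) x (-1) _ bd2 (by linarith [pos1 (-1) hy]))
          (fun s hs => hspx x hx s ⟨hs.1.le, hs.2.le⟩)
        simp only [up2] at this
        have : 0 ≤ 1 / ε * (1 - x) := mul_nonneg eip.le (by linarith [hx.2])
        linarith
      have hxo : x ∈ Ioo (-1 : ℝ) 1 := ⟨hx1, hx2⟩
      have hyo : y ∈ Ioo (-1 : ℝ) 1 := ⟨hy1, hy2⟩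
      obtain ⟨-, hdx, hdtx, heqx⟩ := hu.2.2.1 t htp x hxo
      obtain ⟨-, hdy, hdty, heqy⟩ := hu.2.2.1 t htp y hyo
      have H := hess (fun z => u z t) (fun z => ux u z t) x y (uxx u x t) (uxx u y t) (1 / ε) (ε * c)
        hxo hyo (fun z hz => by linarith [pos1 z ⟨hz.1.le, hz.2.le⟩])
        (fun z hz => (hu.2.2.1 t htp z hz).1.hasDerivAt) hdx.hasDerivAt hdy.hasDerivAt
        (fun x' hx' y' hy' => hspx x' ⟨hx'.1.le, hx'.2.le⟩ y' ⟨hy'.1.le, hy'.2.le⟩)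
      have px : 0 < u x t := by linarith [pos1 x hx]
      have py : 0 < u y t := by linarith [pos1 y hy]
      have Hx := (H 1 0).1
      have Hy := (H 0 1).1
      simp only [one_mul, zero_mul, add_zero, zero_add] at Hx Hy
      set A1 := 1 / √(1 + ux u x t ^ 2) with hA1
      set A2 := 1 / √(1 + ux u y t ^ 2) with hA2
      have s1 : A1 ^ 2 = 1 / (1 + ux u x t ^ 2) := by
        rw [hA1, div_pow, Real.sq_sqrt (by positivity), one_pow]
      have s2 : A2 ^ 2 = 1 / (1 + ux u y t ^ 2) := by
        rw [hA2, div_pow, Real.sq_sqrt (by positivity), one_pow]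
      have HH := (H A1 (-A2)).2
      have hz' := hz
      simp only [Psi] at hz'
      have AB := alg_bound G M c1 R P E D ε c x y (u x t) (u y t) (ux u x t) (ux u y t) A1 A2
        hG hM hc11 hR hP hE hD hε hεc hcp.le hcle hx hy (pos1 x hx).le (hbM t htT x hx)
        (pos1 y hy).le (hbM t htT y hy) (hbG t htT x hx) (hbG t htT y hy) Hx Hy hz' hA1 hA2
      have tx : A1 ^ 2 * (uxx u x t / u x t) = ut u x t / u x t := by
        rw [heqx, s1]; ring
      have ty : A2 ^ 2 * (uxx u y t / u y t) = ut u y t / u y t := by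
        rw [heqy, s2]; ring
      have Htime := deriv_left_nonpos (a := t) (b := t0) ht.1
        (g := fun s => Psi (fun z => u z s) (1 / ε) (ε * (c0 + K * (s - t0))) x y)
        (g' := ε * K * (2 + x ^ 2 + y ^ 2) / 2 - ut u x t / u x t + ut u y t / u y t) ?_ ?_
      · have h4 : ε * K ≤ ε * K * (2 + x ^ 2 + y ^ 2) / 2 := by
          have : ε * K * (2 + x ^ 2 + y ^ 2) / 2 = ε * K + ε * K * (x ^ 2 + y ^ 2) / 2 := by ring
          have : 0 ≤ ε * K * (x ^ 2 + y ^ 2) / 2 := by positivity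
          linarith
        have e5 : ε * K = ε * (D ^ 2 + 2 * c1 + 2 * D + 4 * G * P + 8 * G ^ 2 * D) + ε := by
          rw [hK]; ring
        have e6 : A1 ^ 2 * (uxx u x t / u x t - (ux u x t / u x t) ^ 2)
          = A1 ^ 2 * (uxx u x t / u x t) - A1 ^ 2 * (ux u x t / u x t) ^ 2 := by ring
        have e7 : (-A2) ^ 2 * (uxx u y t / u y t - (ux u y t / u y t) ^ 2)
          = A2 ^ 2 * (uxx u y t / u y t) - A2 ^ 2 * (ux u y t / u y t) ^ 2 := by ring
        have e8 : 2 * A1 * -A2 * (1 / ε) = -(2 * A1 * A2 * (1 / ε)) := by ring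
        have e9 : (-A2) ^ 2 = A2 ^ 2 := by ring
        rw [e6, e7, e8, e9, tx, ty] at HH
        linarith
      · have d1 : HasDerivAt (fun s => c0 + K * (s - t0)) K t := by
          simpa using (((hasDerivAt_id t).sub_const t0).const_mul K).const_add c0
        have d2 := ((d1.const_mul ε).mul_const (2 + x ^ 2 + y ^ 2)).div_const 2
        have d3 := hdtx.hasDerivAt.log px.ne'
        have d4 := hdty.hasDerivAt.log py.ne'
        have := (((d2.const_add (1 / ε * (x + y) ^ 2 / 2)).add_const ((x ^ 2 - y ^ 2) / 2)).sub d3).add d4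
        exact this
      · intro s hs
        have := htm s ⟨hs.1.le, hs.2⟩
        rw [hcdef] at hz
        linarith
  intro t ht x hx
  have hx' : -x ∈ Icc (-1 : ℝ) 1 := ⟨by linarith [hx.2], by linarith [hx.1]⟩
  have hlim : ∀ ε : ℝ, 0 < ε → ε * c1 ≤ 1 →
      Real.log (u x t) - Real.log (u (-x) t) ≤ ε * (2 * c1) := by
    intro ε hε hεc
    have := main ε hε hεc (x, -x) ⟨hx, hx'⟩ t ht
    simp only [Psi] at this
    have e1 : 1 / ε * (x + -x) ^ 2 / 2 = 0 := by simp
    have e2 : (x ^ 2 - (-x) ^ 2) / 2 = 0 := by ring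
    have a2 : K * (t - t0) ≤ K * (t1 - t0) := by gcongr; exact ht.2
    have a3 : c0 + K * (t - t0) ≤ c1 := by linarith
    have e3 : 2 + x ^ 2 + (-x) ^ 2 ≤ 4 := by nlinarith [hx.1, hx.2]
    have a4 : ε * (c0 + K * (t - t0)) * (2 + x ^ 2 + (-x) ^ 2) ≤ ε * c1 * 4 := by gcongr
    linarith
  by_contra! hcon
  set δ := Real.log (u x t) - Real.log (u (-x) t) with hδ
  have hδp : 0 < δ := by linarith
  have h := hlim (min (1 / c1) (δ / (4 * c1))) (by positivity) (by
    calc min (1 / c1) (δ / (4 * c1)) * c1 ≤ 1 / c1 * c1 := by gcongr; exact min_le_left _ _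
      _ = 1 := by field_simp)
  have : min (1 / c1) (δ / (4 * c1)) * (2 * c1) ≤ δ / (4 * c1) * (2 * c1) := by
    gcongr; exact min_le_right _ _
  have : δ / (4 * c1) * (2 * c1) = δ / 2 := by field_simp; norm_num
  linarith

lemma hasDeriv_all (u : ℝ → ℝ → ℝ) (u0 : ℝ → ℝ) (hu : IsGlobalSolB u u0)
    (hu0C1 : ContDiffOn ℝ 1 u0 (Icc (-1 : ℝ) 1)) :
    (∀ x ∈ Ioo (-1 : ℝ) 1, ux u x 0 = derivWithin u0 (Icc (-1 : ℝ) 1) x) ∧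
    ∀ t ≥ (0 : ℝ), ∀ x ∈ Ioo (-1 : ℝ) 1, HasDerivAt (fun y => u y t) (ux u x t) x := by
  obtain ⟨hc, hcx, hintr, hbd, hini⟩ := hu
  have h0 : ∀ x ∈ Ioo (-1 : ℝ) 1,
      HasDerivAt (fun y => u y 0) (derivWithin u0 (Icc (-1 : ℝ) 1) x) x := by
    intro x hx
    have hd : DifferentiableWithinAt ℝ u0 (Icc (-1 : ℝ) 1) x :=
      hu0C1.differentiableOn (by norm_num) x (Ioo_subset_Icc_self hx)
    have hn : Icc (-1 : ℝ) 1 ∈ 𝓝 x := Icc_mem_nhds hx.1 hx.2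
    have := hd.hasDerivWithinAt.hasDerivAt hn
    refine this.congr_of_eventuallyEq ?_
    filter_upwards [hn] with y hy using hini y hy
  refine ⟨fun x hx => (h0 x hx).deriv, ?_⟩
  intro t ht x hx
  rcases eq_or_lt_of_le ht with h | h
  · subst h
    have e := (h0 x hx)
    have e2 : ux u x 0 = _ := e.deriv
    rw [e2]; exact e
  · exact (hintr t h x hx).1.hasDerivAt

lemma log_lip (u : ℝ → ℝ → ℝ) (u0 : ℝ → ℝ) (hu : IsGlobalSolB u u0)
    (hu0C1 : ContDiffOn ℝ 1 u0 (Icc (-1 : ℝ) 1))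
    (hpos : ∀ t ≥ (0 : ℝ), ∀ x ∈ Icc (-1 : ℝ) 1, 1 / 2 < u x t) (G t : ℝ) (ht : 0 ≤ t)
    (hbG : ∀ x ∈ Icc (-1 : ℝ) 1, |ux u x t| ≤ G) :
    ∀ x ∈ Icc (-1 : ℝ) 1, ∀ y ∈ Icc (-1 : ℝ) 1,
      Real.log (u x t) - Real.log (u y t) ≤ 2 * G * |x - y| := by
  have hd := (hasDeriv_all u u0 hu hu0C1).2 t ht
  have hcont : ContinuousOn (fun y => u y t) (Icc (-1 : ℝ) 1) :=
    hu.1.comp (f := fun y : ℝ => (y, t)) (by fun_prop) (fun y hy => ⟨hy, ht⟩)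
  have hcl : ContinuousOn (fun y => Real.log (u y t)) (Icc (-1 : ℝ) 1) :=
    hcont.log (fun y hy => by have := hpos t ht y hy; linarith)
  have key : ∀ x ∈ Icc (-1 : ℝ) 1, ∀ y ∈ Icc (-1 : ℝ) 1, x < y →
      |Real.log (u y t) - Real.log (u x t)| ≤ 2 * G * (y - x) := by
    intro x hx y hy hxy
    obtain ⟨c, hcm, hce⟩ := exists_hasDerivAt_eq_slope (fun z => Real.log (u z t))
      (fun z => ux u z t / u z t) hxy (hcl.mono (Icc_subset_Icc hx.1 hy.2)) (by
        intro z hz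
        have hz' : z ∈ Ioo (-1 : ℝ) 1 := ⟨by linarith [hx.1, hz.1], by linarith [hy.2, hz.2]⟩
        have := hpos t ht z (Ioo_subset_Icc_self hz')
        exact (hd z hz').log (by linarith))
    have hc' : c ∈ Icc (-1 : ℝ) 1 := ⟨by linarith [hx.1, hcm.1], by linarith [hy.2, hcm.2]⟩
    have hp := hpos t ht c hc'
    have hg := hbG c hc'
    have hyx : 0 < y - x := by linarith
    rw [eq_div_iff hyx.ne'] at hce
    rw [← hce, abs_mul, abs_of_pos hyx, abs_div, abs_of_pos (by linarith : 0 < u c t)]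
    refine mul_le_mul_of_nonneg_right ?_ hyx.le
    rw [div_le_iff₀ (by linarith)]
    have : 0 ≤ G := (abs_nonneg _).trans hg
    nlinarith
  intro x hx y hy
  rcases lt_trichotomy x y with h | h | h
  · have := key x hx y hy h
    rw [abs_sub_comm, abs_of_pos (by linarith : 0 < y - x)]
    linarith [neg_abs_le (Real.log (u y t) - Real.log (u x t))]
  · subst h; simp
  · have := key y hy x hx h
    rw [abs_of_pos (by linarith : 0 < x - y)]
    linarith [le_abs_self (Real.log (u x t) - Real.log (u y t))]

lemma even_all (u : ℝ → ℝ → ℝ) (u0 : ℝ → ℝ) (hu : IsGlobalSolB u u0)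
    (hu0C1 : ContDiffOn ℝ 1 u0 (Icc (-1 : ℝ) 1))
    (heven : ∀ x ∈ Icc (-1 : ℝ) 1, u0 x = u0 (-x))
    (hpos : ∀ t ≥ (0 : ℝ), ∀ x ∈ Icc (-1 : ℝ) 1, 1 / 2 < u x t) :
    ∀ t ≥ (0 : ℝ), ∀ x ∈ Icc (-1 : ℝ) 1, u x t = u (-x) t := by
  intro T hT
  have hKc : IsCompact (Icc (-1 : ℝ) 1 ×ˢ Icc (0 : ℝ) T) := isCompact_Icc.prod isCompact_Icc
  have hsub : Icc (-1 : ℝ) 1 ×ˢ Icc (0 : ℝ) T ⊆ Icc (-1 : ℝ) 1 ×ˢ Ici (0 : ℝ) :=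
    prod_mono le_rfl Icc_subset_Ici_self
  obtain ⟨M', hM'⟩ := hKc.exists_bound_of_continuousOn (hu.1.mono hsub)
  obtain ⟨G', hG'⟩ := hKc.exists_bound_of_continuousOn (hu.2.1.mono hsub)
  obtain ⟨M, hMd⟩ : ∃ M, M = max 1 M' := ⟨_, rfl⟩
  obtain ⟨G, hGd⟩ : ∃ G, G = max 1 G' := ⟨_, rfl⟩
  have hM : 1 ≤ M := hMd ▸ le_max_left _ _
  have hG : 1 ≤ G := hGd ▸ le_max_left _ _
  have hbM : ∀ t ∈ Icc 0 T, ∀ x ∈ Icc (-1 : ℝ) 1, u x t ≤ M := fun t ht x hx =>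
    (le_abs_self _).trans ((hM' (x, t) ⟨hx, ht⟩).trans (hMd ▸ le_max_right _ _))
  have hbG : ∀ t ∈ Icc 0 T, ∀ x ∈ Icc (-1 : ℝ) 1, |ux u x t| ≤ G := fun t ht x hx =>
    (hG' (x, t) ⟨hx, ht⟩).trans (hGd ▸ le_max_right _ _)
  obtain ⟨c0, hc0⟩ : ∃ c0, c0 = (2 * G + 1) ^ 2 := ⟨_, rfl⟩
  obtain ⟨c1, hc1⟩ : ∃ c1, c1 = c0 + 1 := ⟨_, rfl⟩
  obtain ⟨R, hR⟩ : ∃ R, R = 2 * G + 2 := ⟨_, rfl⟩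
  obtain ⟨P, hP⟩ : ∃ P, P = 2 * c1 + R := ⟨_, rfl⟩
  obtain ⟨E, hE⟩ : ∃ E, E = R ^ 2 / 2 + 2 * c1 + R := ⟨_, rfl⟩
  obtain ⟨D, hD⟩ : ∃ D, D = M * P + M * E * (2 * G) := ⟨_, rfl⟩
  obtain ⟨K, hK⟩ : ∃ K, K = (D ^ 2 + 2 * c1 + 2 * D + 4 * G * P + 8 * G ^ 2 * D) + 1 := ⟨_, rfl⟩
  have pc0 : 0 < c0 := by rw [hc0]; positivity
  have pc1 : 0 < c1 := by rw [hc1]; positivity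
  have pR : 0 < R := by rw [hR]; positivity
  have pP : 0 < P := by rw [hP]; positivity
  have pE : 0 < E := by rw [hE]; positivity
  have pD : 0 < D := by rw [hD]; positivity
  have pK : 0 < K := by rw [hK]; positivity
  have ind : ∀ n : ℕ, ∀ t ∈ Icc 0 T, t * K ≤ n → ∀ x ∈ Icc (-1 : ℝ) 1, u x t = u (-x) t := by
    intro n
    induction n with
    | zero =>
      intro t ht h x hx
      have : t = 0 := le_antisymm (by
        by_contra! hlt
        have := mul_pos hlt pK
        simp at h; linarith) ht.1
      subst this
      have hx' : -x ∈ Icc (-1 : ℝ) 1 := ⟨by linarith [hx.2], by linarith [hx.1]⟩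
      rw [hu.2.2.2.2 x hx, hu.2.2.2.2 (-x) hx', heven x hx]
    | succ n ih =>
      intro t ht h x hx
      by_cases hn : t * K ≤ n
      · exact ih t ht hn x hx
      push Not at hn
      have ht0 : (n : ℝ) / K ∈ Icc 0 T := ⟨by positivity, by
        rw [div_le_iff₀ pK]; nlinarith [ht.2]⟩
      have htt : (n : ℝ) / K ≤ t := by rw [div_le_iff₀ pK]; linarith
      have hs := even_step u u0 hu hpos T G M c0 c1 R P E D K hG hM hbM hbG hc0 hc1 hR hP hE hD hK
        pK (n / K) t ht0.1 ht.2 (by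
          push_cast at h
          rw [sub_mul, div_mul_cancel₀ _ pK.ne']; linarith)
        (log_lip u u0 hu hu0C1 hpos G _ ht0.1 (hbG _ ht0))
        (ih _ ht0 (by rw [div_mul_cancel₀ _ pK.ne'])) t ⟨htt, le_rfl⟩
      have hx' : -x ∈ Icc (-1 : ℝ) 1 := ⟨by linarith [hx.2], by linarith [hx.1]⟩
      have h1 := hs x hx
      have h2 := hs (-x) hx'
      rw [neg_neg] at h2
      have p1 := hpos t ht.1 x hx
      have p2 := hpos t ht.1 (-x) hx'
      exact Real.log_injOn_pos (mem_Ioi.2 (by linarith)) (mem_Ioi.2 (by linarith)) (le_antisymm h1 h2)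
  obtain ⟨n, hn⟩ := exists_nat_ge (T * K)
  exact ind n T ⟨hT, le_rfl⟩ hn

noncomputable def Tn (B v : ℝ) : ℝ := Real.tan (max (-B) (min B v))

lemma clip_mem (B v : ℝ) (hB : 0 < B) : max (-B) (min B v) ∈ Icc (-B) B :=
  ⟨le_max_left _ _, max_le (by linarith) (min_le_left _ _)⟩

lemma cos_ge (B q : ℝ) (hB2 : B < π / 2) (hq : q ∈ Icc (-B) B) :
    Real.cos B ≤ Real.cos q := by
  rw [← Real.cos_abs q]
  exact Real.cos_le_cos_of_nonneg_of_le_pi (abs_nonneg _) (by linarith [Real.pi_pos]) (abs_le.2 hq)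

lemma Tn_cont (B : ℝ) (hB : 0 < B) (hB2 : B < π / 2) : Continuous (Tn B) := by
  unfold Tn
  have hcB : 0 < Real.cos B := Real.cos_pos_of_mem_Ioo ⟨by linarith, hB2⟩
  rw [continuous_iff_continuousAt]
  intro v
  have h1 : Real.cos (max (-B) (min B v)) ≠ 0 :=
    (hcB.trans_le (cos_ge B _ hB2 (clip_mem B v hB))).ne'
  exact ContinuousAt.comp (f := fun v => max (-B) (min B v)) (Real.continuousAt_tan.2 h1)
    (by fun_prop)

lemma Tn_eq (B v : ℝ) (h : v ∈ Icc (-B) B) : Tn B v = Real.tan v := by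
  unfold Tn
  rw [min_eq_right h.2, max_eq_right h.1]

lemma Tn_odd (B v : ℝ) (hB : 0 < B) : Tn B (-v) = - Tn B v := by
  unfold Tn
  rw [← Real.tan_neg]
  congr 1
  rw [← min_neg_neg, neg_neg, ← max_neg_neg]
  rcases le_total v B with h | h <;> rcases le_total (-B) v with h' | h' <;>
    simp only [max_def, min_def] <;> split_ifs <;> linarith

lemma Tn_lip (B v v' : ℝ) (hB : 0 < B) (hB2 : B < π / 2) (h : v' ≤ v) :
    Tn B v - Tn B v' ≤ 1 / Real.cos B ^ 2 * (v - v') := by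
  unfold Tn
  have hcB : 0 < Real.cos B := Real.cos_pos_of_mem_Ioo ⟨by linarith, hB2⟩
  have hp := clip_mem B v' hB
  have hq := clip_mem B v hB
  have hpq : max (-B) (min B v') ≤ max (-B) (min B v) :=
    max_le_max le_rfl (min_le_min le_rfl h)
  have hd : max (-B) (min B v) - max (-B) (min B v') ≤ v - v' := by
    simp only [max_def, min_def]; split_ifs <;> linarith
  generalize max (-B) (min B v) = q at *
  generalize max (-B) (min B v') = p at *
  have cq := cos_ge B q hB2 hq
  have cp := cos_ge B p hB2 hp
  have pq : 0 < Real.cos q := by linarith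
  have pp : 0 < Real.cos p := by linarith
  have e : Real.tan q - Real.tan p = Real.sin (q - p) / (Real.cos q * Real.cos p) := by
    rw [Real.tan_eq_sin_div_cos, Real.tan_eq_sin_div_cos, Real.sin_sub]
    field_simp
  rw [e, div_mul_eq_mul_div, one_mul]
  have hs : Real.sin (q - p) ≤ q - p := Real.sin_le (by linarith)
  apply div_le_div₀ (by linarith) (by linarith) (by positivity)
  rw [sq]; exact mul_le_mul cq cp hcB.le pq.le

noncomputable def Vf (η σ k y s : ℝ) : ℝ := (η + σ * s - k) * y + k * y ^ 3

noncomputable def Uf (B η σ k x s : ℝ) : ℝ := ∫ y in (0 : ℝ)..x, Tn B (Vf η σ k y s)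

lemma Vf_cont (η σ k : ℝ) : Continuous (fun p : ℝ × ℝ => Vf η σ k p.1 p.2) := by
  unfold Vf; fun_prop

lemma TV_cont (B η σ k s : ℝ) (hB : 0 < B) (hB2 : B < π / 2) :
    Continuous (fun y => Tn B (Vf η σ k y s)) :=
  (Tn_cont B hB hB2).comp ((Vf_cont η σ k).comp (by fun_prop : Continuous fun y : ℝ => (y, s)))

lemma Uf_cont (B η σ k : ℝ) (hB : 0 < B) (hB2 : B < π / 2) :
    Continuous (fun p : ℝ × ℝ => Uf B η σ k p.1 p.2) := by
  have := intervalIntegral.continuous_parametric_intervalIntegral_of_continuous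
    (μ := MeasureTheory.volume) (a₀ := (0 : ℝ)) (f := fun (p : ℝ × ℝ) (y : ℝ) => Tn B (Vf η σ k y p.2))
    (s := fun p : ℝ × ℝ => p.1) ?_ continuous_fst
  · exact this
  · exact (Tn_cont B hB hB2).comp ((Vf_cont η σ k).comp
      (by fun_prop : Continuous fun q : (ℝ × ℝ) × ℝ => (q.2, q.1.2)))

lemma Uf_deriv (B η σ k x s : ℝ) (hB : 0 < B) (hB2 : B < π / 2) :
    HasDerivAt (fun x => Uf B η σ k x s) (Tn B (Vf η σ k x s)) x :=
  (TV_cont B η σ k s hB hB2).integral_hasStrictDerivAt 0 x |>.hasDerivAt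

lemma Uf_even (B η σ k x s : ℝ) (hB : 0 < B) : Uf B η σ k (-x) s = Uf B η σ k x s := by
  unfold Uf
  have h := intervalIntegral.integral_comp_neg (a := 0) (b := x) (fun y => Tn B (Vf η σ k y s))
  have e : ∀ y, Tn B (Vf η σ k (-y) s) = - Tn B (Vf η σ k y s) := by
    intro y
    rw [← Tn_odd B _ hB]; congr 1; unfold Vf; ring
  simp only [e, intervalIntegral.integral_neg, neg_zero] at h
  rw [intervalIntegral.integral_symm, ← h, neg_neg]

lemma Uf_inc (B η σ k x y s s' : ℝ) (hB : 0 < B) (hB2 : B < π / 2) (hσ : 0 ≤ σ)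
    (hy : 0 ≤ y) (hyx : y ≤ x) (hs : s' ≤ s) :
    (Uf B η σ k x s - Uf B η σ k y s) - (Uf B η σ k x s' - Uf B η σ k y s') ≤
      1 / Real.cos B ^ 2 * (σ * (s - s') * ((x ^ 2 - y ^ 2) / 2)) := by
  unfold Uf
  have hi : ∀ r a b, IntervalIntegrable (fun z => Tn B (Vf η σ k z r)) MeasureTheory.volume a b :=
    fun r a b => (TV_cont B η σ k r hB hB2).intervalIntegrable a b
  rw [intervalIntegral.integral_interval_sub_left (hi _ _ _) (hi _ _ _),
    intervalIntegral.integral_interval_sub_left (hi _ _ _) (hi _ _ _),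
    ← intervalIntegral.integral_sub (hi _ _ _) (hi _ _ _)]
  have e : ∫ z in y..x, (1 / Real.cos B ^ 2 * (σ * (s - s'))) * z =
      1 / Real.cos B ^ 2 * (σ * (s - s') * ((x ^ 2 - y ^ 2) / 2)) := by
    rw [intervalIntegral.integral_const_mul, integral_id]; ring
  rw [← e]
  apply intervalIntegral.integral_mono_on hyx ((hi _ _ _).sub (hi _ _ _))
  · exact (by fun_prop : Continuous fun z : ℝ => (1 / Real.cos B ^ 2 * (σ * (s - s'))) * z).intervalIntegrable _ _
  · intro z hz
    have hz0 : 0 ≤ z := hy.trans hz.1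
    have hv : Vf η σ k z s - Vf η σ k z s' = σ * (s - s') * z := by unfold Vf; ring
    have := Tn_lip B (Vf η σ k z s) (Vf η σ k z s') hB hB2 (by
      have : 0 ≤ σ * (s - s') * z := mul_nonneg (mul_nonneg hσ (by linarith)) hz0
      linarith)
    rw [hv] at this
    linarith

lemma TV_deriv (B η σ k x s : ℝ) (hB2 : B < π / 2) (hV : Vf η σ k x s ∈ Ioo (-B) B) :
    HasDerivAt (fun y => Tn B (Vf η σ k y s))
      ((1 + Tn B (Vf η σ k x s) ^ 2) * (η + σ * s - k + 3 * k * x ^ 2)) x := by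
  have hc : 0 < Real.cos (Vf η σ k x s) :=
    Real.cos_pos_of_mem_Ioo ⟨by linarith [hV.1], by linarith [hV.2]⟩
  have hVd : HasDerivAt (fun y => Vf η σ k y s) (η + σ * s - k + 3 * k * x ^ 2) x := by
    unfold Vf
    have := ((hasDerivAt_id x).const_mul (η + σ * s - k)).add ((hasDerivAt_pow 3 x).const_mul k)
    exact this.congr_deriv (by norm_num; ring)
  have h1 := (Real.hasDerivAt_tan hc.ne').comp x hVd
  rw [Tn_eq B _ (Ioo_subset_Icc_self hV)]
  have e : 1 / Real.cos (Vf η σ k x s) ^ 2 = 1 + Real.tan (Vf η σ k x s) ^ 2 := by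
    rw [Real.tan_eq_sin_div_cos]
    field_simp
    linarith [Real.sin_sq_add_cos_sq (Vf η σ k x s)]
  rw [e] at h1
  refine h1.congr_of_eventuallyEq ?_
  have : ∀ᶠ y in 𝓝 x, Vf η σ k y s ∈ Ioo (-B) B :=
    hVd.continuousAt.eventually (isOpen_Ioo.mem_nhds hV)
  filter_upwards [this] with y hy
  exact Tn_eq B _ (Ioo_subset_Icc_self hy)

lemma compare (u : ℝ → ℝ → ℝ) (u0 : ℝ → ℝ) (hu : IsGlobalSolB u u0)
    (hu0C1 : ContDiffOn ℝ 1 u0 (Icc (-1 : ℝ) 1))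
    (hpos : ∀ t ≥ (0 : ℝ), ∀ x ∈ Icc (-1 : ℝ) 1, 1 / 2 < u x t)
    (hev : ∀ t ≥ (0 : ℝ), ∀ x ∈ Icc (-1 : ℝ) 1, u x t = u (-x) t)
    (B η σ k T : ℝ) (hB : 0 < B) (hB2 : B < π / 2) (hσ : 0 ≤ σ) (hT : 0 ≤ T)
    (hC : 1 / Real.cos B ^ 2 * σ / 2 ≤ 3 * k)
    (hV : ∀ s ∈ Icc 0 T, ∀ y ∈ Icc (0 : ℝ) 1, Vf η σ k y s ∈ Ioo (-B) B)
    (hb1 : ∀ s ∈ Ioc 0 T, Real.tan (Vf η σ k 1 s) < u 1 s)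
    (hini : ∀ x ∈ Ioo (0 : ℝ) 1, Tn B (Vf η σ k x 0) ≤ ux u x 0) (ε : ℝ) (hε : 0 < ε)
    (x y : ℝ) (hy : 0 ≤ y) (hyx : y ≤ x) (hx : x ≤ 1) :
    0 < (u x T - Uf B η σ k x T) - (u y T - Uf B η σ k y T) + ε * (1 + T) := by
  obtain ⟨hd0, hd⟩ := hasDeriv_all u u0 hu hu0C1
  have hbdy := bdry_deriv u u0 hu hpos
  obtain ⟨hc, hcx, hintr, hbd, hi0⟩ := hu
  have hcU := Uf_cont B η σ k hB hB2
  have hKc : IsCompact {q : ℝ × ℝ | 0 ≤ q.2 ∧ q.2 ≤ q.1 ∧ q.1 ≤ 1} := by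
    refine (isCompact_Icc (a := ((0 : ℝ), (0 : ℝ))) (b := (1, 1))).of_isClosed_subset ?_ ?_
    · exact (isClosed_le continuous_const continuous_snd).inter
        ((isClosed_le continuous_snd continuous_fst).inter
          (isClosed_le continuous_fst continuous_const))
    · rintro ⟨a, b⟩ ⟨h1, h2, h3⟩
      simp only at h1 h2 h3
      exact ⟨⟨by simp; linarith, by simp; linarith⟩, ⟨by simp; linarith, by simp; linarith⟩⟩
  have key := first_touch {q : ℝ × ℝ | 0 ≤ q.2 ∧ q.2 ≤ q.1 ∧ q.1 ≤ 1} hKc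
    (fun q s => (u q.1 s - Uf B η σ k q.1 s) - (u q.2 s - Uf B η σ k q.2 s) + ε * (1 + s)) 0 T
    ?_ ?_ ?_
  · exact key (x, y) ⟨hy, hyx, hx⟩ T ⟨hT, le_rfl⟩
  · have c1 : ContinuousOn (fun p : (ℝ × ℝ) × ℝ => u p.1.1 p.2)
        ({q : ℝ × ℝ | 0 ≤ q.2 ∧ q.2 ≤ q.1 ∧ q.1 ≤ 1} ×ˢ Icc 0 T) :=
      hc.comp (f := fun p : (ℝ × ℝ) × ℝ => (p.1.1, p.2)) (by fun_prop) (by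
        rintro ⟨⟨a, b⟩, s⟩ ⟨⟨h1, h2, h3⟩, h4⟩
        simp only at h1 h2 h3 h4
        exact ⟨⟨by simp; linarith, by simpa using h3⟩, h4.1⟩)
    have c2 : ContinuousOn (fun p : (ℝ × ℝ) × ℝ => u p.1.2 p.2)
        ({q : ℝ × ℝ | 0 ≤ q.2 ∧ q.2 ≤ q.1 ∧ q.1 ≤ 1} ×ˢ Icc 0 T) :=
      hc.comp (f := fun p : (ℝ × ℝ) × ℝ => (p.1.2, p.2)) (by fun_prop) (by
        rintro ⟨⟨a, b⟩, s⟩ ⟨⟨h1, h2, h3⟩, h4⟩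
        simp only at h1 h2 h3 h4
        exact ⟨⟨by simp; linarith, by simp; linarith⟩, h4.1⟩)
    have c3 : Continuous (fun p : (ℝ × ℝ) × ℝ => Uf B η σ k p.1.1 p.2) :=
      Continuous.comp (g := fun p : ℝ × ℝ => Uf B η σ k p.1 p.2)
        (f := fun p : (ℝ × ℝ) × ℝ => (p.1.1, p.2)) hcU (by fun_prop)
    have c4 : Continuous (fun p : (ℝ × ℝ) × ℝ => Uf B η σ k p.1.2 p.2) :=
      Continuous.comp (g := fun p : ℝ × ℝ => Uf B η σ k p.1 p.2)
        (f := fun p : (ℝ × ℝ) × ℝ => (p.1.2, p.2)) hcU (by fun_prop)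
    exact ((c1.sub c3.continuousOn).sub (c2.sub c4.continuousOn)).add (by fun_prop)
  · rintro ⟨a, b⟩ ⟨h1, h2, h3⟩
    simp only at h1 h2 h3 ⊢
    have hmono : MonotoneOn (fun z => u z 0 - Uf B η σ k z 0) (Icc (0 : ℝ) 1) := by
      apply monotoneOn_of_deriv_nonneg (convex_Icc _ _)
      · refine ContinuousOn.sub ?_ ?_
        · exact hc.comp (f := fun z : ℝ => (z, (0 : ℝ))) (by fun_prop)
            (fun z hz => ⟨⟨by linarith [hz.1], hz.2⟩, mem_Ici.2 le_rfl⟩)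
        · exact (Continuous.comp (g := fun p : ℝ × ℝ => Uf B η σ k p.1 p.2)
            (f := fun z : ℝ => (z, (0 : ℝ))) hcU (by fun_prop)).continuousOn
      · intro z hz
        rw [interior_Icc] at hz
        exact ((hd 0 le_rfl z ⟨by linarith [hz.1], hz.2⟩).sub
          (Uf_deriv B η σ k z 0 hB hB2)).differentiableAt.differentiableWithinAt
      · intro z hz
        rw [interior_Icc] at hz
        have e := ((hd 0 le_rfl z ⟨by linarith [hz.1], hz.2⟩).sub
          (Uf_deriv B η σ k z 0 hB hB2)).deriv
        have e' : deriv (fun z => u z 0 - Uf B η σ k z 0) z = _ := e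
        rw [e']
        linarith [hini z hz]
    have := hmono ⟨h1, h2.trans h3⟩ ⟨h1.trans h2, h3⟩ h2
    simp only at this
    linarith
  · rintro ⟨a, b⟩ ⟨h1, h2, h3⟩ s hs h0 hsp htm
    simp only at h1 h2 h3 h0 htm
    have hsp' : ∀ p q, 0 ≤ q → q ≤ p → p ≤ 1 →
        0 ≤ (u p s - Uf B η σ k p s) - (u q s - Uf B η σ k q s) + ε * (1 + s) :=
      fun p q hq hqp hp => hsp (p, q) ⟨hq, hqp, hp⟩
    have hsI : s ∈ Icc 0 T := ⟨hs.1.le, hs.2⟩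
    have hba : b < a := by
      rcases h2.eq_or_lt with h | h
      · subst h
        have : 0 < ε * (1 + s) := mul_pos hε (by linarith [hs.1])
        linarith
      · exact h
    rcases h3.eq_or_lt with ha | ha
    · subst ha
      have hdv := ((hbdy s hs.1).1).sub (Uf_deriv B η σ k 1 s hB hB2)
      have := deriv_left_nonpos hba hdv (fun z hz => by
        have := hsp' z b h1 hz.1.le hz.2.le
        simp only [Pi.sub_apply]
        linarith)
      rw [Tn_eq B _ (Ioo_subset_Icc_self (hV s hsI 1 ⟨by norm_num, le_rfl⟩))] at this
      linarith [hb1 s hs]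
    have hao : a ∈ Ioo (-1 : ℝ) 1 := ⟨by linarith, ha⟩
    have hbo : b ∈ Ioo (-1 : ℝ) 1 := ⟨by linarith, by linarith⟩
    obtain ⟨-, hda2, hdat, haeq⟩ := hintr s hs.1 a hao
    obtain ⟨-, hdb2, hdbt, hbeq⟩ := hintr s hs.1 b hbo
    have hseca := second_deriv_nonneg (a := a)
      (g := fun z => u z s - Uf B η σ k z s)
      (g1 := fun z => ux u z s - Tn B (Vf η σ k z s))
      (h2 := hda2.hasDerivAt.sub (TV_deriv B η σ k a s hB2 (hV s hsI a ⟨by linarith, h3⟩))) ?_ ?_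
    rotate_left
    · filter_upwards [isOpen_Ioo.mem_nhds hao] with z hz
      exact (hd s hs.1.le z hz).sub (Uf_deriv B η σ k z s hB hB2)
    · filter_upwards [isOpen_Ioo.mem_nhds (show a ∈ Ioo b 1 from ⟨hba, ha⟩)] with z hz
      have := hsp' z b h1 hz.1.le hz.2.le
      linarith
    have hsecb := second_deriv_nonneg (a := b)
      (g := fun z => Uf B η σ k z s - u z s)
      (g1 := fun z => Tn B (Vf η σ k z s) - ux u z s)
      (h2 := (TV_deriv B η σ k b s hB2 (hV s hsI b ⟨h1, by linarith⟩)).sub hdb2.hasDerivAt) ?_ ?_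
    rotate_left
    · filter_upwards [isOpen_Ioo.mem_nhds hbo] with z hz
      exact (Uf_deriv B η σ k z s hB hB2).sub (hd s hs.1.le z hz)
    · filter_upwards [isOpen_Ioo.mem_nhds (show b ∈ Ioo (-a) a from ⟨by linarith, hba⟩)] with z hz
      have hz' : |z| ≤ a := abs_le.2 ⟨hz.1.le, hz.2.le⟩
      have := hsp' a |z| (abs_nonneg z) hz' h3
      have e1 : u |z| s = u z s := by
        rcases abs_choice z with h | h
        · rw [h]
        · rw [h]; exact (hev s hs.1.le z ⟨by linarith [hz.1], by linarith [hz.2]⟩).symm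
      have e2 : Uf B η σ k |z| s = Uf B η σ k z s := by
        rcases abs_choice z with h | h
        · rw [h]
        · rw [h]; exact Uf_even B η σ k z s hB
      rw [e1, e2] at this
      linarith
    obtain ⟨ea1, ea2⟩ := hseca
    obtain ⟨eb1, eb2⟩ := hsecb
    have ta : η + σ * s - k + 3 * k * a ^ 2 ≤ ut u a s := by
      have e : Tn B (Vf η σ k a s) = ux u a s := by linarith
      rw [e] at ea2
      rw [haeq, le_div_iff₀ (by positivity)]
      unfold uxx
      linarith
    have tb : ut u b s ≤ η + σ * s - k + 3 * k * b ^ 2 := by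
      have e : Tn B (Vf η σ k b s) = ux u b s := by linarith
      rw [e] at eb2
      rw [hbeq, div_le_iff₀ (by positivity)]
      unfold uxx
      linarith
    obtain ⟨Q, hQ⟩ : ∃ Q, Q = 1 / Real.cos B ^ 2 * σ / 2 * (a ^ 2 - b ^ 2) := ⟨_, rfl⟩
    have hgd : HasDerivAt (fun r => u a r - u b r + ε * r - Q * r)
        (ut u a s - ut u b s + ε - Q) s := by
      have := ((hdat.hasDerivAt.sub hdbt.hasDerivAt).add ((hasDerivAt_id s).const_mul ε)).sub
        ((hasDerivAt_id s).const_mul Q)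
      exact this.congr_deriv (by unfold ut; ring)
    have tt := deriv_left_nonpos hs.1 hgd (fun r hr => by
      have i1 := htm r ⟨hr.1.le, hr.2⟩
      have i2 := Uf_inc B η σ k a b s r hB hB2 hσ h1 h2 hr.2.le
      have i3 : 1 / Real.cos B ^ 2 * (σ * (s - r) * ((a ^ 2 - b ^ 2) / 2)) = Q * (s - r) := by
        rw [hQ]; ring
      rw [i3] at i2
      linarith)
    have hab2 : 0 ≤ a ^ 2 - b ^ 2 := by nlinarith
    have := mul_le_mul_of_nonneg_right hC hab2
    rw [← hQ] at this
    linarith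

lemma compare_deriv (u : ℝ → ℝ → ℝ) (u0 : ℝ → ℝ) (hu : IsGlobalSolB u u0)
    (hu0C1 : ContDiffOn ℝ 1 u0 (Icc (-1 : ℝ) 1))
    (hpos : ∀ t ≥ (0 : ℝ), ∀ x ∈ Icc (-1 : ℝ) 1, 1 / 2 < u x t)
    (hev : ∀ t ≥ (0 : ℝ), ∀ x ∈ Icc (-1 : ℝ) 1, u x t = u (-x) t)
    (B η σ k T : ℝ) (hB : 0 < B) (hB2 : B < π / 2) (hσ : 0 ≤ σ) (hT : 0 ≤ T)
    (hC : 1 / Real.cos B ^ 2 * σ / 2 ≤ 3 * k)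
    (hV : ∀ s ∈ Icc 0 T, ∀ y ∈ Icc (0 : ℝ) 1, Vf η σ k y s ∈ Ioo (-B) B)
    (hb1 : ∀ s ∈ Ioc 0 T, Real.tan (Vf η σ k 1 s) < u 1 s)
    (hini : ∀ x ∈ Ioo (0 : ℝ) 1, Tn B (Vf η σ k x 0) ≤ ux u x 0)
    (x : ℝ) (hx : x ∈ Ioo (0 : ℝ) 1) : Real.tan (Vf η σ k x T) ≤ ux u x T := by
  have hmono : ∀ p q, 0 ≤ q → q ≤ p → p ≤ 1 →
      u q T - Uf B η σ k q T ≤ u p T - Uf B η σ k p T := by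
    intro p q hq hqp hp
    apply le_of_forall_pos_le_add
    intro e he
    have hT1 : 0 < 1 + T := by linarith
    have := compare u u0 hu hu0C1 hpos hev B η σ k T hB hB2 hσ hT hC hV hb1 hini (e / (1 + T))
      (by positivity) p q hq hqp hp
    rw [div_mul_cancel₀ _ hT1.ne'] at this
    linarith
  have hdv := ((hasDeriv_all u u0 hu hu0C1).2 T hT x ⟨by linarith [hx.1], hx.2⟩).sub
    (Uf_deriv B η σ k x T hB hB2)
  have := deriv_right_nonneg hx.2 hdv (fun z hz => by
    simp only [Pi.sub_apply]
    exact hmono z x hx.1.le hz.1.le hz.2.le)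
  rw [Tn_eq B _ (Ioo_subset_Icc_self (hV T ⟨hT, le_rfl⟩ x ⟨hx.1.le, hx.2.le⟩))] at this
  linarith

lemma tan_mono' {a b : ℝ} (h1 : -(π / 2) < a) (h2 : a ≤ b) (h3 : b < π / 2) :
    Real.tan a ≤ Real.tan b :=
  Real.strictMonoOn_tan.monotoneOn ⟨h1, by linarith⟩ ⟨by linarith, h3⟩ h2

lemma main_lower (u0 : ℝ → ℝ)
    (hu0C1 : ContDiffOn ℝ 1 u0 (Icc (-1 : ℝ) 1))
    (heven : ∀ x ∈ Icc (-1 : ℝ) 1, u0 x = u0 (-x))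
    (hb : ∀ x ∈ Icc (-1 : ℝ) 1, 1 ≤ u0 x)
    (hslope : ∀ x ∈ Ioo (0 : ℝ) 1, 0 < derivWithin u0 (Icc (-1 : ℝ) 1) x)
    (hend : derivWithin u0 (Icc (-1 : ℝ) 1) 1 = u0 1)
    (u : ℝ → ℝ → ℝ) (hu : IsGlobalSolB u u0)
    (hev : ∀ t ≥ (0 : ℝ), ∀ x ∈ Icc (-1 : ℝ) 1, u x t = u (-x) t) (a : ℝ) (ha : 0 < a)
    (ha2 : a < π / 2) :
    ∃ Tstar > (0 : ℝ), ∀ t ≥ Tstar, ∀ x ∈ Ioo (0 : ℝ) 1, Real.tan (a * x) ≤ ux u x t := by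
  have hgr := growth u u0 hu hb
  have hpos : ∀ t ≥ (0 : ℝ), ∀ x ∈ Icc (-1 : ℝ) 1, 1 / 2 < u x t := fun t ht x hx => by
    have := hgr t ht x hx
    nlinarith [sq_nonneg x]
  obtain ⟨hd0, -⟩ := hasDeriv_all u u0 hu hu0C1
  obtain ⟨m, hm0, hm⟩ : ∃ m > 0, ∀ x ∈ Icc (1 / 2 : ℝ) 1,
      m ≤ derivWithin u0 (Icc (-1 : ℝ) 1) x := by
    have hcd : ContinuousOn (derivWithin u0 (Icc (-1 : ℝ) 1)) (Icc (-1 : ℝ) 1) :=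
      hu0C1.continuousOn_derivWithin (uniqueDiffOn_Icc (by norm_num)) le_rfl
    obtain ⟨z, hz, hmin⟩ := (isCompact_Icc (a := (1 / 2 : ℝ)) (b := 1)).exists_isMinOn
      ⟨1, by norm_num, le_rfl⟩ (hcd.mono (Icc_subset_Icc (by norm_num) le_rfl))
    refine ⟨_, ?_, fun x hx => hmin hx⟩
    rcases hz.2.eq_or_lt with h | h
    · rw [h, hend]
      linarith [hb 1 ⟨by norm_num, le_rfl⟩]
    · exact hslope z ⟨by linarith [hz.1], h⟩
  obtain ⟨d, hd⟩ : ∃ d, d = (π / 2 - a) / 3 := ⟨_, rfl⟩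
  have pd : 0 < d := by rw [hd]; linarith
  obtain ⟨η, pη, hη1, hη2, hη3, hη4⟩ : ∃ η > 0, η ≤ Real.arctan m ∧ 2 * η ≤ Real.arctan (1 / 2) ∧
      4 * η / 3 ≤ d ∧ η ≤ a := by
    have q1 : 0 < Real.arctan m := Real.arctan_pos.2 hm0
    have q2 : 0 < Real.arctan (1 / 2) := Real.arctan_pos.2 (by norm_num)
    refine ⟨min (min (Real.arctan m) (Real.arctan (1 / 2) / 2)) (min (3 * d / 4) a), ?_, ?_, ?_, ?_, ?_⟩
    · exact lt_min (lt_min q1 (by linarith)) (lt_min (by linarith) ha)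
    · exact (min_le_left _ _).trans (min_le_left _ _)
    · have := (min_le_left (min (Real.arctan m) (Real.arctan (1 / 2) / 2)) (min (3 * d / 4) a)).trans
        (min_le_right _ _)
      linarith
    · have := (min_le_right (min (Real.arctan m) (Real.arctan (1 / 2) / 2)) (min (3 * d / 4) a)).trans
        (min_le_left _ _)
      linarith
    · exact (min_le_right _ _).trans (min_le_right _ _)
  obtain ⟨k, hk⟩ : ∃ k, k = 4 * η / 3 := ⟨_, rfl⟩
  obtain ⟨bf, hbf⟩ : ∃ bf, bf = a + d := ⟨_, rfl⟩
  obtain ⟨B, hBd⟩ : ∃ B, B = a + 2 * d := ⟨_, rfl⟩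
  have pk : 0 < k := by rw [hk]; linarith
  have hB : 0 < B := by linarith
  have hB2 : B < π / 2 := by linarith
  obtain ⟨C0, hC0⟩ : ∃ C0, C0 = 1 / Real.cos B ^ 2 := ⟨_, rfl⟩
  have pC0 : 0 ≤ C0 := by rw [hC0]; positivity
  obtain ⟨T1, hT1⟩ : ∃ T1, T1 = 4 * Real.tan bf := ⟨_, rfl⟩
  have pT1 : 0 < T1 := by
    have := Real.tan_pos_of_pos_of_lt_pi_div_two (x := bf) (by linarith) (by linarith)
    linarith
  have ph : η < bf := by linarith
  refine ⟨max (bf * T1 / η) (C0 * (bf - η) / (6 * k)), lt_max_of_lt_left (by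
    have : 0 < bf := by linarith
    positivity), ?_⟩
  intro t ht x hx
  have ht1 : bf * T1 ≤ t * η := by
    have := (le_max_left _ _).trans ht
    rwa [div_le_iff₀ pη] at this
  have ht2 : C0 * (bf - η) ≤ t * (6 * k) := by
    have := (le_max_right _ _).trans ht
    rwa [div_le_iff₀ (by positivity)] at this
  have pt : 0 < t := by
    by_contra! h
    have : 0 < bf * T1 := mul_pos (by linarith) pT1
    nlinarith
  obtain ⟨σ, hσ⟩ : ∃ σ, σ = (bf - η) / t := ⟨_, rfl⟩
  have pσ : 0 ≤ σ := by rw [hσ]; exact div_nonneg (by linarith) pt.le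
  have hσt : σ * t = bf - η := by rw [hσ, div_mul_cancel₀ _ pt.ne']
  have hVup : ∀ s ≥ 0, ∀ y ∈ Icc (0 : ℝ) 1, Vf η σ k y s ≤ η + σ * s := by
    intro s hs y hy
    unfold Vf
    have e : (η + σ * s - k) * y + k * y ^ 3 =
      (η + σ * s) - (η + σ * s) * (1 - y) - k * (y * ((1 - y) * (1 + y))) := by ring
    have e1 : 0 ≤ (η + σ * s) * (1 - y) :=
      mul_nonneg (by have := mul_nonneg pσ hs; linarith) (by linarith [hy.2])
    have e2 : 0 ≤ k * (y * ((1 - y) * (1 + y))) :=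
      mul_nonneg pk.le (mul_nonneg hy.1 (mul_nonneg (by linarith [hy.2]) (by linarith [hy.1])))
    linarith
  have hVlo : ∀ s ≥ 0, ∀ y ∈ Icc (0 : ℝ) 1, -k ≤ Vf η σ k y s := by
    intro s hs y hy
    unfold Vf
    have e : (η + σ * s - k) * y + k * y ^ 3 =
      -k + (η + σ * s) * y + k * (1 - y) + k * y ^ 3 := by ring
    have e1 : 0 ≤ (η + σ * s) * y :=
      mul_nonneg (by have := mul_nonneg pσ hs; linarith) hy.1
    have e2 : 0 ≤ k * (1 - y) := mul_nonneg pk.le (by linarith [hy.2])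
    have e3 : 0 ≤ k * y ^ 3 := mul_nonneg pk.le (pow_nonneg hy.1 3)
    linarith
  have hVB : ∀ s ∈ Icc 0 t, ∀ y ∈ Icc (0 : ℝ) 1, Vf η σ k y s ∈ Ioo (-B) B := by
    intro s hs y hy
    have h1 := hVup s hs.1 y hy
    have h2 := hVlo s hs.1 y hy
    have h3 := mul_le_mul_of_nonneg_left hs.2 pσ
    exact ⟨by linarith, by linarith⟩
  have key := compare_deriv u u0 hu hu0C1 hpos hev B η σ k t hB hB2 pσ pt.le ?_ hVB ?_ ?_ x hx
  · refine le_trans (tan_mono' ?_ ?_ ?_) key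
    · have := mul_pos ha hx.1
      linarith [Real.pi_pos]
    · unfold Vf
      rw [hσt]
      have e1 : 0 ≤ k * x ^ 3 := mul_nonneg pk.le (pow_nonneg hx.1.le 3)
      have e2 : a * x ≤ (η + (bf - η) - k) * x :=
        mul_le_mul_of_nonneg_right (by linarith) hx.1.le
      linarith
    · have := (hVB t ⟨pt.le, le_rfl⟩ x ⟨hx.1.le, hx.2.le⟩).2
      linarith
  · rw [← hC0]
    have : C0 * σ = C0 * (bf - η) / t := by rw [hσ]; ring
    have h2 : C0 * σ ≤ 6 * k := by
      rw [this, div_le_iff₀ pt]; linarith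
    linarith
  · intro s hs
    have hg := hgr s hs.1.le 1 ⟨by norm_num, le_rfl⟩
    have e : Vf η σ k 1 s = η + σ * s := by unfold Vf; ring
    rw [e]
    have p1 : 0 ≤ σ * s := mul_nonneg pσ hs.1.le
    rcases le_total s T1 with h | h
    · have h1 : σ * s ≤ η := by
        rw [hσ, div_mul_eq_mul_div, div_le_iff₀ pt]
        have : (bf - η) * s ≤ bf * T1 :=
          mul_le_mul (by linarith) h hs.1.le (by linarith)
        linarith
      have h2 := tan_mono' (a := η + σ * s) (b := Real.arctan (1 / 2)) (by linarith) (by linarith)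
        (Real.arctan_lt_pi_div_two _)
      rw [Real.tan_arctan] at h2
      linarith [hs.1]
    · have h1 := mul_le_mul_of_nonneg_left hs.2 pσ
      have h2 := tan_mono' (a := η + σ * s) (b := bf) (by linarith) (by linarith) (by linarith)
      linarith
  · intro z hz
    rw [hd0 z ⟨by linarith [hz.1], hz.2⟩]
    have hzI : z ∈ Icc (0 : ℝ) 1 := ⟨hz.1.le, hz.2.le⟩
    have hvb := hVB 0 ⟨le_rfl, pt.le⟩ z hzI
    rw [Tn_eq B _ (Ioo_subset_Icc_self hvb)]
    rcases le_total z (1 / 2) with h | h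
    · have hv : Vf η σ k z 0 ≤ 0 := by
        unfold Vf
        have e : (η + σ * 0 - k) * z + k * z ^ 3 =
          -(4 * η / 3 * (z * ((1 / 2 - z) * (1 / 2 + z)))) := by rw [hk]; ring
        rw [e]
        have : 0 ≤ 4 * η / 3 * (z * ((1 / 2 - z) * (1 / 2 + z))) :=
          mul_nonneg (by linarith) (mul_nonneg hz.1.le (mul_nonneg (by linarith) (by linarith [hz.1])))
        linarith
      have := tan_mono' (a := Vf η σ k z 0) (b := 0) (by linarith [hvb.1]) hv (by linarith)
      rw [Real.tan_zero] at this
      linarith [hslope z hz]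
    · have h1 := hVup 0 le_rfl z hzI
      have h2 := tan_mono' (a := Vf η σ k z 0) (b := Real.arctan m) (by linarith [hvb.1]) (by linarith)
        (Real.arctan_lt_pi_div_two _)
      rw [Real.tan_arctan] at h2
      exact h2.trans (hm z ⟨h, hz.2.le⟩)

end helpers

/-- finer lower gradient estimate for symmetric solutions.
With `u0` even, `1 ≤ u0 ≤ M0`, `0 < u0' < tan(πx/2)` on `(0,1)` and
`u0'(1) = u0(1)`, for every `h0 > 0` there exists `T* > 0` such that for
`t ≥ T*` and `x ∈ (0,1)`: `u_x(x,t) ≥ tan((arctan h0)x) > 0` and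
`u_x(-x,t) ≤ -tan((arctan h0)x) < 0`. -/
theorem stmt_10 (M0 : ℝ) (hM0 : 0 < M0) (u0 : ℝ → ℝ)
    (hu0C1 : ContDiffOn ℝ 1 u0 (Set.Icc (-1 : ℝ) 1))
    (heven : ∀ x ∈ Set.Icc (-1 : ℝ) 1, u0 x = u0 (-x))
    (hbounds : ∀ x ∈ Set.Icc (-1 : ℝ) 1, 1 ≤ u0 x ∧ u0 x ≤ M0)
    (hslope : ∀ x ∈ Set.Ioo (0 : ℝ) 1,
      0 < derivWithin u0 (Set.Icc (-1 : ℝ) 1) x ∧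
      derivWithin u0 (Set.Icc (-1 : ℝ) 1) x < Real.tan (π * x / 2))
    (hend : derivWithin u0 (Set.Icc (-1 : ℝ) 1) 1 = u0 1)
    (u : ℝ → ℝ → ℝ) (hu : IsGlobalSolB u u0) :
    ∀ h0 > (0 : ℝ), ∃ Tstar > (0 : ℝ), ∀ t ≥ Tstar, ∀ x ∈ Set.Ioo (0 : ℝ) 1,
      (Real.tan (Real.arctan h0 * x) ≤ ux u x t ∧
        0 < Real.tan (Real.arctan h0 * x)) ∧
      (ux u (-x) t ≤ -Real.tan (Real.arctan h0 * x) ∧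
        -Real.tan (Real.arctan h0 * x) < 0) := by
  intro h0 hh0
  have hb : ∀ x ∈ Set.Icc (-1 : ℝ) 1, 1 ≤ u0 x := fun x hx => (hbounds x hx).1
  have hpos : ∀ t ≥ (0 : ℝ), ∀ x ∈ Set.Icc (-1 : ℝ) 1, 1 / 2 < u x t := fun t ht x hx => by
    have := growth u u0 hu hb t ht x hx
    nlinarith [sq_nonneg x]
  have hev := even_all u u0 hu hu0C1 heven hpos
  have ha : 0 < Real.arctan h0 := Real.arctan_pos.2 hh0
  have ha2 := Real.arctan_lt_pi_div_two h0
  obtain ⟨Ts, hTs, hmain⟩ := main_lower u0 hu0C1 heven hb (fun x hx => (hslope x hx).1) hend u hu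
    hev (Real.arctan h0) ha ha2
  refine ⟨Ts, hTs, fun t ht x hx => ?_⟩
  have ht0 : 0 ≤ t := hTs.le.trans ht
  have hlow := hmain t ht x hx
  have htan : 0 < Real.tan (Real.arctan h0 * x) :=
    Real.tan_pos_of_pos_of_lt_pi_div_two (mul_pos ha hx.1) (by nlinarith [hx.1, hx.2])
  have hneg : ux u (-x) t = - ux u x t := by
    have hd := (hasDeriv_all u u0 hu hu0C1).2 t ht0 x ⟨by linarith [hx.1], hx.2⟩
    have hd' : HasDerivAt (fun y => u y t) (ux u x t) (-(-x)) := by rwa [neg_neg]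
    have h1 := hd'.comp (-x) (hasDerivAt_neg (-x))
    have h2 : HasDerivAt (fun y => u y t) (ux u x t * -1) (-x) := by
      refine h1.congr_of_eventuallyEq ?_
      have : Set.Icc (-1 : ℝ) 1 ∈ nhds (-x) :=
        Icc_mem_nhds (by linarith [hx.2]) (by linarith [hx.1])
      filter_upwards [this] with y hy
      exact hev t ht0 y hy
    have h3 : ux u (-x) t = ux u x t * -1 := h2.deriv
    rw [h3]; ring
  refine ⟨⟨hlow, htan⟩, ?_, by linarith⟩
  rw [hneg]; linarith
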